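/- arXiv:1010.0836 — 9 statements merged into one kernel-verified Lean document; each statement's English description precedes it below -/
import Mathlib

section
/- Let X, Y be random variables with values in ℝ^p and ℝ^q, let P denote the joint law of (X,Y) on ℝ^{p+q} and Q = P_x ⊗ P_y the product of the marginal laws. Let W be a finite nonnegative Borel measure on ℝ^{p+q} whose Fourier transform λ(z) = ∫ e^{-i⟨z,u⟩} dW(u) factorizes as λ(x,y) = k(x)·l(y) for bounded continuous functions k : ℝ^p → ℝ and l : ℝ^q → ℝ. Then, if (X,Y) and (X',Y') are independent with common law P, H := ∫ |f_P(u) − f_Q(u)|² dW(u) = E[k(X−X') l(Y−Y')] + E[k(X−X')]·E[l(Y−Y')] − 2 E[ E[k(X−X') | X] · E[l(Y−Y') | Y] ], where in the second term X−X' and Y−Y' are formed from independent copies so that E[k(X−X')] = ∫∫ k(x−x') dP_x(x) dP_x(x') and E[l(Y−Y')] = ∫∫ l(y−y') dP_y(y) dP_y(y'), and the conditional expectations in the last term are over the independent copy: E[k(X−X')|X=x] = ∫ k(x−x') dP_x(x'), E[l(Y−Y')|Y=y] = ∫ l(y−y') dP_y(y'). -/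
open MeasureTheory Complex
open scoped RealInnerProductSpace ComplexConjugate

section

variable {E F : Type*} [NormedAddCommGroup E] [InnerProductSpace ℝ E]
  [NormedAddCommGroup F] [InnerProductSpace ℝ F]

/-- The character `z ↦ exp (i⟨u, z⟩)` on the product of two inner product spaces. -/
noncomputable def prodChar (u z : E × F) : ℂ :=
  Complex.exp (Complex.I * ((⟪u.1, z.1⟫ : ℝ) + (⟪u.2, z.2⟫ : ℝ)))

lemma norm_prodChar (u z : E × F) : ‖prodChar u z‖ = 1 := by
  rw [prodChar, mul_comm, ← Complex.ofReal_add, Complex.norm_exp_ofReal_mul_I]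

lemma conj_prodChar (u z : E × F) :
    conj (prodChar u z)
      = Complex.exp (-Complex.I * ((⟪z.1, u.1⟫ : ℝ) + (⟪z.2, u.2⟫ : ℝ))) := by
  rw [prodChar, ← Complex.exp_conj, real_inner_comm u.1, real_inner_comm u.2]
  simp

lemma prodChar_mul_conj (u z z' : E × F) :
    prodChar u z * conj (prodChar u z') = prodChar u (z - z') := by
  rw [prodChar, prodChar, prodChar, ← Complex.exp_conj, ← Complex.exp_add]
  congr 1
  simp [inner_sub_right]
  ring

variable [MeasurableSpace E] [MeasurableSpace F]

lemma integral_prodChar_mul_conj_integral (A B : Measure (E × F)) [SFinite A] [SFinite B]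
    (u : E × F) :
    (∫ z, prodChar u z ∂A) * conj (∫ z, prodChar u z ∂B)
      = ∫ v, prodChar u v.1 * conj (prodChar u v.2) ∂(A.prod B) := by
  rw [← integral_conj, ← integral_prod_mul]

variable [BorelSpace E] [SecondCountableTopology E] [BorelSpace F] [SecondCountableTopology F]

lemma integrable_prodChar_mul_conj (W A B : Measure (E × F)) [IsFiniteMeasure W]
    [IsFiniteMeasure A] [IsFiniteMeasure B] :
    Integrable (fun w : (E × F) × (E × F) × (E × F) =>
      prodChar w.1 w.2.1 * conj (prodChar w.1 w.2.2)) (W.prod (A.prod B)) := by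
  refine Integrable.of_bound (C := 1) (Continuous.aestronglyMeasurable ?_) ?_
  · unfold prodChar
    fun_prop
  · exact Filter.Eventually.of_forall fun w => by
      simp [norm_prodChar]

lemma integrable_integral_prodChar_mul_conj (W A B : Measure (E × F)) [IsFiniteMeasure W]
    [IsFiniteMeasure A] [IsFiniteMeasure B] :
    Integrable (fun u => (∫ z, prodChar u z ∂A) * conj (∫ z, prodChar u z ∂B)) W := by
  simp_rw [integral_prodChar_mul_conj_integral]
  exact (integrable_prodChar_mul_conj W A B).integral_prod_left

/-- If `K` is the Fourier transform of `W`, the `L²(W)` inner product of two characteristic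
functions is the double integral of the kernel `K (z - z')`. -/
lemma integral_re_integral_prodChar_mul_conj (W A B : Measure (E × F)) [IsFiniteMeasure W]
    [IsFiniteMeasure A] [IsFiniteMeasure B] {K : E × F → ℝ}
    (hK : ∀ z, ∫ u, prodChar u z ∂W = K z) :
    ∫ u, ((∫ z, prodChar u z ∂A) * conj (∫ z, prodChar u z ∂B)).re ∂W
      = ∫ z, ∫ z', K (z - z') ∂B ∂A := by
  have hint := integrable_prodChar_mul_conj W A B
  have hKint : Integrable (fun v : (E × F) × (E × F) => ((K (v.1 - v.2) : ℝ) : ℂ))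
      (A.prod B) := by
    simpa only [prodChar_mul_conj, hK] using hint.integral_prod_right
  have hre := integral_re (integrable_integral_prodChar_mul_conj W A B)
  simp only [RCLike.re_to_complex] at hre
  rw [hre]
  simp_rw [integral_prodChar_mul_conj_integral]
  rw [integral_integral_swap hint]
  simp only [prodChar_mul_conj, hK]
  rw [integral_complex_ofReal, Complex.ofReal_re, integral_prod]
  exact hKint.re

end

lemma Complex.norm_sub_sq_eq_re (a b : ℂ) :
    ‖a - b‖ ^ 2 = (a * conj a).re + (b * conj b).re - 2 * (a * conj b).re := by
  rw [← Complex.normSq_eq_norm_sq, Complex.normSq_sub, Complex.mul_conj, Complex.mul_conj,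
    Complex.ofReal_re, Complex.ofReal_re]

/-- **HSIC as an expectation of kernels.**
Let `P` be the joint law of `(X, Y)` on `ℝ^p × ℝ^q` and `Q = Pₓ ⊗ P_y` the
product of the marginals.  If the Fourier transform `λ` of a finite weight
measure `W` factorizes as `λ(x,y) = k(x)·l(y)` with `k, l` bounded continuous
and real-valued, then
`H = ∫ |f_P − f_Q|² dW = E[k(X−X')l(Y−Y')] + E[k(X−X')]·E[l(Y−Y')]
  − 2 E[E[k(X−X')|X]·E[l(Y−Y')|Y]]`,
where `(X', Y')` is an independent copy, so all the expectations are
expressed as integrals against `P`, `Pₓ` and `P_y`. -/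
theorem hsic_eq_kernel_expectations
    (p q : ℕ) {Ω : Type*} [MeasurableSpace Ω] (μ : Measure Ω) [IsProbabilityMeasure μ]
    (X : Ω → EuclideanSpace ℝ (Fin p)) (Y : Ω → EuclideanSpace ℝ (Fin q))
    (hX : Measurable X) (hY : Measurable Y)
    (P : Measure (EuclideanSpace ℝ (Fin p) × EuclideanSpace ℝ (Fin q)))
    (hP : P = μ.map (fun ω => (X ω, Y ω)))
    (Px : Measure (EuclideanSpace ℝ (Fin p))) (hPx : Px = μ.map X)
    (Py : Measure (EuclideanSpace ℝ (Fin q))) (hPy : Py = μ.map Y)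
    (Q : Measure (EuclideanSpace ℝ (Fin p) × EuclideanSpace ℝ (Fin q)))
    (hQ : Q = Px.prod Py)
    (W : Measure (EuclideanSpace ℝ (Fin p) × EuclideanSpace ℝ (Fin q)))
    [IsFiniteMeasure W]
    (k : EuclideanSpace ℝ (Fin p) → ℝ) (l : EuclideanSpace ℝ (Fin q) → ℝ)
    (hk_cont : Continuous k) (hk_bdd : ∃ C, ∀ x, |k x| ≤ C)
    (hl_cont : Continuous l) (hl_bdd : ∃ C, ∀ y, |l y| ≤ C)
    (hfactor : ∀ z : EuclideanSpace ℝ (Fin p) × EuclideanSpace ℝ (Fin q),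
      (∫ u, Complex.exp (-Complex.I * ((⟪z.1, u.1⟫ : ℝ) + (⟪z.2, u.2⟫ : ℝ))) ∂W)
        = (k z.1 * l z.2 : ℝ))
    (fP fQ : EuclideanSpace ℝ (Fin p) × EuclideanSpace ℝ (Fin q) → ℂ)
    (hfP : ∀ u, fP u = ∫ z, Complex.exp (Complex.I * ((⟪u.1, z.1⟫ : ℝ) + (⟪u.2, z.2⟫ : ℝ))) ∂P)
    (hfQ : ∀ u, fQ u = ∫ z, Complex.exp (Complex.I * ((⟪u.1, z.1⟫ : ℝ) + (⟪u.2, z.2⟫ : ℝ))) ∂Q) :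
    ∫ u, ‖fP u - fQ u‖ ^ 2 ∂W =
      (∫ z, ∫ z', k (z.1 - z'.1) * l (z.2 - z'.2) ∂P ∂P)
        + (∫ x, ∫ x', k (x - x') ∂Px ∂Px) * (∫ y, ∫ y', l (y - y') ∂Py ∂Py)
        - 2 * ∫ z, (∫ x', k (z.1 - x') ∂Px) * (∫ y', l (z.2 - y') ∂Py) ∂P := by
  have hXY : Measurable fun ω => (X ω, Y ω) := hX.prodMk hY
  have : IsProbabilityMeasure P := hP ▸ Measure.isProbabilityMeasure_map hXY.aemeasurable
  have : IsProbabilityMeasure Px := hPx ▸ Measure.isProbabilityMeasure_map hX.aemeasurable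
  have : IsProbabilityMeasure Py := hPy ▸ Measure.isProbabilityMeasure_map hY.aemeasurable
  have : IsProbabilityMeasure Q := hQ ▸ inferInstance
  have hK : ∀ z, ∫ u, prodChar u z ∂W = ((k z.1 * l z.2 : ℝ) : ℂ) := fun z => by
    rw [← Complex.conj_ofReal, ← hfactor z, ← integral_conj]
    simp_rw [← conj_prodChar, Complex.conj_conj]
  have hQint : ∀ z : EuclideanSpace ℝ (Fin p) × EuclideanSpace ℝ (Fin q),
      ∫ z', k (z.1 - z'.1) * l (z.2 - z'.2) ∂Q
        = (∫ x', k (z.1 - x') ∂Px) * (∫ y', l (z.2 - y') ∂Py) := fun z => by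
    rw [hQ, integral_prod_mul (fun x' => k (z.1 - x')) (fun y' => l (z.2 - y'))]
  have hPP := integral_re_integral_prodChar_mul_conj W P P hK
  have hPQ := integral_re_integral_prodChar_mul_conj W P Q hK
  have hQQ := integral_re_integral_prodChar_mul_conj W Q Q hK
  simp only [Prod.fst_sub, Prod.snd_sub, hQint] at hPP hPQ hQQ
  rw [hQ, integral_prod_mul (fun x => ∫ x', k (x - x') ∂Px) (fun y => ∫ y', l (y - y') ∂Py),
    ← hQ] at hQQ
  obtain rfl : fP = fun u => ∫ z, prodChar u z ∂P := funext hfP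
  obtain rfl : fQ = fun u => ∫ z, prodChar u z ∂Q := funext hfQ
  have iPP := (integrable_integral_prodChar_mul_conj W P P).re
  have iPQ := (integrable_integral_prodChar_mul_conj W P Q).re
  have iQQ := (integrable_integral_prodChar_mul_conj W Q Q).re
  simp only [RCLike.re_to_complex] at iPP iPQ iQQ
  simp_rw [Complex.norm_sub_sq_eq_re]
  have hsub := integral_sub (iPP.add iQQ) (iPQ.const_mul 2)
  simp only [Pi.add_apply] at hsub
  rw [hsub, integral_add iPP iQQ, integral_const_mul,
    hPP, hPQ, hQQ]
end

section
/- Let x_1,…,x_n ∈ ℝ^p and y_1,…,y_n ∈ ℝ^q be samples, and let σ_x, σ_y > 0. Define the empirical characteristic functions f^n_{XY}(s,t) = (1/n)∑_{j=1}^n e^{i(⟨s,x_j⟩+⟨t,y_j⟩)}, f^n_X(s) = (1/n)∑_{j=1}^n e^{i⟨s,x_j⟩}, f^n_Y(t) = (1/n)∑_{j=1}^n e^{i⟨t,y_j⟩}, and the Gaussian weight W(s,t) = (σ_x/√(2π))^p (σ_y/√(2π))^q exp(−σ_x²‖s‖²/2) exp(−σ_y²‖t‖²/2). Then ∫_{ℝ^q}∫_{ℝ^p}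 |f^n_{XY}(s,t) − f^n_X(s) f^n_Y(t)|² W(s,t) ds dt = (1/n²)∑_{j,k} k_{jk} l_{jk} − (2/n³)∑_{j,q,r} k_{jq} l_{jr} + (1/n⁴)(∑_{j,k} k_{jk})(∑_{q,r} l_{qr}), where k_{jk} = exp(−‖x_j − x_k‖²/(2σ_x²)), l_{qr} = exp(−‖y_q − y_r‖²/(2σ_y²)), and all sums run over indices in {1,…,n}. -/
open MeasureTheory Complex Real
open scoped RealInnerProductSpace BigOperators

/-- The normalized Gaussian weight on a Euclidean space of dimension `p`. -/
noncomputable def gaussianWeight (p : ℕ) (σ : ℝ) (s : EuclideanSpace ℝ (Fin p)) : ℝ :=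
  (σ / Real.sqrt (2 * π)) ^ p * Real.exp (-(σ ^ 2 * ‖s‖ ^ 2) / 2)

lemma gaussianWeight_mul_cexp_eq (p : ℕ) (σ : ℝ) (s w : EuclideanSpace ℝ (Fin p)) :
    (gaussianWeight p σ s : ℂ) * Complex.exp (Complex.I * (⟪s, w⟫ : ℝ)) =
      ((σ / Real.sqrt (2 * π)) ^ p : ℝ) *
        Complex.exp (-((σ ^ 2 / 2 : ℝ) : ℂ) * ‖s‖ ^ 2 + Complex.I * (⟪w, s⟫ : ℝ)) := by
  rw [gaussianWeight, Complex.ofReal_mul, mul_assoc, Complex.ofReal_exp, ← Complex.exp_add,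
    real_inner_comm]
  congr 3
  push_cast
  ring

lemma integrable_gaussianWeight_mul_cexp {p : ℕ} {σ : ℝ} (hσ : 0 < σ)
    (w : EuclideanSpace ℝ (Fin p)) :
    Integrable fun s => (gaussianWeight p σ s : ℂ) *
      Complex.exp (Complex.I * (⟪s, w⟫ : ℝ)) := by
  simp_rw [gaussianWeight_mul_cexp_eq]
  refine (GaussianFourier.integrable_cexp_neg_mul_sq_norm_add ?_ _ _).const_mul _
  rw [Complex.ofReal_re]
  positivity

lemma integral_gaussianWeight_mul_cexp {p : ℕ} {σ : ℝ} (hσ : 0 < σ)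
    (w : EuclideanSpace ℝ (Fin p)) :
    ∫ s, (gaussianWeight p σ s : ℂ) * Complex.exp (Complex.I * (⟪s, w⟫ : ℝ)) =
      (Real.exp (-‖w‖ ^ 2 / (2 * σ ^ 2)) : ℝ) := by
  simp_rw [gaussianWeight_mul_cexp_eq]
  have hb : 0 < σ ^ 2 / 2 := by positivity
  rw [integral_const_mul, GaussianFourier.integral_cexp_neg_mul_sq_norm_add
    (by rwa [Complex.ofReal_re]), finrank_euclideanSpace_fin, ← mul_assoc]
  have hbase : π / (σ ^ 2 / 2) = (Real.sqrt (2 * π) / σ) ^ 2 := by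
    rw [div_pow, Real.sq_sqrt (by positivity)]
    field_simp
  have hpow : ((π : ℂ) / ((σ ^ 2 / 2 : ℝ) : ℂ)) ^ ((p : ℂ) / 2) =
      (((Real.sqrt (2 * π) / σ) ^ p : ℝ) : ℂ) := by
    have hr : (π / (σ ^ 2 / 2)) ^ ((p : ℝ) / 2) = (Real.sqrt (2 * π) / σ) ^ p := by
      rw [hbase, ← Real.rpow_natCast _ 2, ← Real.rpow_mul (by positivity),
        ← Real.rpow_natCast _ p]
      congr 1
      push_cast
      ring
    rw [← hr, Complex.ofReal_cpow (by positivity)]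
    push_cast
    rfl
  have hs : Real.sqrt (2 * π) ≠ 0 := by positivity
  rw [hpow, ← Complex.ofReal_mul, ← mul_pow, div_mul_div_cancel₀ hs, div_self hσ.ne', one_pow,
    Complex.ofReal_one, one_mul, Complex.ofReal_exp]
  congr 1
  rw [Complex.I_sq]
  push_cast
  have hσ' : (σ : ℂ) ≠ 0 := by exact_mod_cast hσ.ne'
  field_simp
  norm_num

/-- The Gaussian-weighted squared modulus of a trigonometric sum with real coefficients. -/
lemma integral_normSq_trigSum_mul_gaussianWeight {ι : Type*} [Fintype ι] {p q : ℕ} {σx σy : ℝ}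
    (hσx : 0 < σx) (hσy : 0 < σy) (c : ι → ℝ) (u : ι → EuclideanSpace ℝ (Fin p))
    (v : ι → EuclideanSpace ℝ (Fin q)) :
    (∫ t, ∫ s, ‖∑ i, (c i : ℂ) *
        Complex.exp (Complex.I * ((⟪s, u i⟫ : ℝ) + (⟪t, v i⟫ : ℝ)))‖ ^ 2 *
        (gaussianWeight p σx s * gaussianWeight q σy t)) =
      ∑ i, ∑ j, c i * c j * (Real.exp (-‖u i - u j‖ ^ 2 / (2 * σx ^ 2)) *
        Real.exp (-‖v i - v j‖ ^ 2 / (2 * σy ^ 2))) := by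
  have expand (s : EuclideanSpace ℝ (Fin p)) (t : EuclideanSpace ℝ (Fin q)) :
      ((‖∑ i, (c i : ℂ) *
        Complex.exp (Complex.I * ((⟪s, u i⟫ : ℝ) + (⟪t, v i⟫ : ℝ)))‖ ^ 2 *
        (gaussianWeight p σx s * gaussianWeight q σy t) : ℝ) : ℂ) =
      ∑ i, ∑ j, ((c i : ℂ) * c j *
        (gaussianWeight q σy t * Complex.exp (Complex.I * (⟪t, v i - v j⟫ : ℝ)))) *
        (gaussianWeight p σx s * Complex.exp (Complex.I * (⟪s, u i - u j⟫ : ℝ))) := by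
    rw [Complex.ofReal_mul, Complex.ofReal_pow, ← Complex.mul_conj', map_sum,
      Finset.sum_mul_sum, Finset.sum_mul]
    refine Finset.sum_congr rfl fun i _ => ?_
    rw [Finset.sum_mul]
    refine Finset.sum_congr rfl fun j _ => ?_
    have hexp : Complex.exp (Complex.I * ((⟪s, u i⟫ : ℝ) + (⟪t, v i⟫ : ℝ))) *
        Complex.exp (-Complex.I * ((⟪s, u j⟫ : ℝ) + (⟪t, v j⟫ : ℝ))) =
        Complex.exp (Complex.I * (⟪t, v i - v j⟫ : ℝ)) *
          Complex.exp (Complex.I * (⟪s, u i - u j⟫ : ℝ)) := by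
      rw [← Complex.exp_add, ← Complex.exp_add, inner_sub_right, inner_sub_right]
      congr 1
      push_cast
      ring
    rw [map_mul, ← Complex.exp_conj, map_mul, map_add, Complex.conj_I, Complex.conj_ofReal,
      Complex.conj_ofReal, Complex.conj_ofReal, Complex.ofReal_mul]
    linear_combination (c i : ℂ) * c j * gaussianWeight p σx s * gaussianWeight q σy t * hexp
  rw [← Complex.ofReal_inj, ← integral_complex_ofReal]
  simp_rw [← integral_complex_ofReal, expand]
  have inner_integral (t : EuclideanSpace ℝ (Fin q)) :
      (∫ s, ∑ i, ∑ j, ((c i : ℂ) * c j *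
        (gaussianWeight q σy t * Complex.exp (Complex.I * (⟪t, v i - v j⟫ : ℝ)))) *
        (gaussianWeight p σx s * Complex.exp (Complex.I * (⟪s, u i - u j⟫ : ℝ)))) =
      ∑ i, ∑ j, ((c i : ℂ) * c j * (Real.exp (-‖u i - u j‖ ^ 2 / (2 * σx ^ 2)) : ℝ)) *
        (gaussianWeight q σy t * Complex.exp (Complex.I * (⟪t, v i - v j⟫ : ℝ))) := by
    rw [integral_finsetSum _ fun i _ => integrable_finsetSum _ fun j _ =>
      (integrable_gaussianWeight_mul_cexp hσx _).const_mul _]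
    refine Finset.sum_congr rfl fun i _ => ?_
    rw [integral_finsetSum _ fun j _ =>
      (integrable_gaussianWeight_mul_cexp hσx _).const_mul _]
    refine Finset.sum_congr rfl fun j _ => ?_
    rw [integral_const_mul, integral_gaussianWeight_mul_cexp hσx]
    ring
  simp_rw [inner_integral]
  rw [integral_finsetSum _ fun i _ => integrable_finsetSum _ fun j _ =>
    (integrable_gaussianWeight_mul_cexp hσy _).const_mul _, Complex.ofReal_sum]
  refine Finset.sum_congr rfl fun i _ => ?_
  rw [integral_finsetSum _ fun j _ =>
    (integrable_gaussianWeight_mul_cexp hσy _).const_mul _, Complex.ofReal_sum]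
  refine Finset.sum_congr rfl fun j _ => ?_
  rw [integral_const_mul, integral_gaussianWeight_mul_cexp hσy]
  push_cast
  ring

/-- The quadratic form of `δ_{ab} / n - 1 / n²` against a product of symmetric kernels. -/
lemma sum_centering_mul_kernels {n : ℕ} (K L : Fin n → Fin n → ℝ)
    (hK : ∀ j k, K j k = K k j) (hL : ∀ j k, L j k = L k j) :
    (∑ i : Fin n × Fin n, ∑ j : Fin n × Fin n,
      ((if i.1 = i.2 then 1 / (n : ℝ) else 0) - 1 / (n : ℝ) ^ 2) *
        ((if j.1 = j.2 then 1 / (n : ℝ) else 0) - 1 / (n : ℝ) ^ 2) *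
        (K i.1 j.1 * L i.2 j.2)) =
      (1 / n ^ 2 : ℝ) * ∑ j, ∑ k, K j k * L j k
        - (2 / n ^ 3 : ℝ) * ∑ j, ∑ a, ∑ b, K j a * L j b
        + (1 / n ^ 4 : ℝ) * (∑ j, ∑ k, K j k) * (∑ a, ∑ b, L a b) := by
  have hdd : (∑ a : Fin n, ∑ b : Fin n, ∑ a' : Fin n, ∑ b' : Fin n,
      (if a = b then 1 / (n : ℝ) else 0) * (if a' = b' then 1 / (n : ℝ) else 0) *
        (K a a' * L b b')) = (1 / n ^ 2 : ℝ) * ∑ j, ∑ k, K j k * L j k := by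
    simp only [ite_mul, mul_ite, mul_zero, zero_mul, Finset.sum_ite_irrel, Finset.sum_const_zero,
      Finset.sum_ite_eq, Finset.mem_univ, if_true, Finset.mul_sum]
    refine Finset.sum_congr rfl fun _ _ => Finset.sum_congr rfl fun _ _ => ?_
    ring
  have hdo : (∑ a : Fin n, ∑ b : Fin n, ∑ a' : Fin n, ∑ b' : Fin n,
      (if a = b then 1 / (n : ℝ) else 0) * (1 / (n : ℝ) ^ 2) *
        (K a a' * L b b')) = (1 / n ^ 3 : ℝ) * ∑ j, ∑ a, ∑ b, K j a * L j b := by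
    simp only [ite_mul, zero_mul, Finset.sum_ite_irrel, Finset.sum_const_zero,
      Finset.sum_ite_eq, Finset.mem_univ, if_true, Finset.mul_sum]
    refine Finset.sum_congr rfl fun _ _ => Finset.sum_congr rfl fun _ _ =>
      Finset.sum_congr rfl fun _ _ => ?_
    ring
  have hod : (∑ a : Fin n, ∑ b : Fin n, ∑ a' : Fin n, ∑ b' : Fin n,
      (1 / (n : ℝ) ^ 2) * (if a' = b' then 1 / (n : ℝ) else 0) *
        (K a a' * L b b')) = (1 / n ^ 3 : ℝ) * ∑ j, ∑ a, ∑ b, K j a * L j b := by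
    simp only [ite_mul, mul_ite, mul_zero, zero_mul,
      Finset.sum_ite_eq, Finset.mem_univ, if_true, Finset.mul_sum]
    calc
      _ = ∑ a : Fin n, ∑ c : Fin n, ∑ b : Fin n,
          1 / (n : ℝ) ^ 2 * (1 / (n : ℝ)) * (K a c * L b c) :=
        Finset.sum_congr rfl fun _ _ => Finset.sum_comm
      _ = _ := by
        rw [Finset.sum_comm]
        refine Finset.sum_congr rfl fun c _ => Finset.sum_congr rfl fun a _ =>
          Finset.sum_congr rfl fun b _ => ?_
        rw [hK a c, hL b c]
        ring
  have hoo : (∑ a : Fin n, ∑ b : Fin n, ∑ a' : Fin n, ∑ b' : Fin n,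
      (1 / (n : ℝ) ^ 2) * (1 / (n : ℝ) ^ 2) * (K a a' * L b b')) =
      (1 / n ^ 4 : ℝ) * (∑ j, ∑ k, K j k) * (∑ a, ∑ b, L a b) := by
    rw [mul_assoc, Finset.sum_mul_sum, Finset.mul_sum]
    simp_rw [Finset.sum_mul_sum, Finset.mul_sum]
    refine Finset.sum_congr rfl fun _ _ => Finset.sum_congr rfl fun _ _ =>
      Finset.sum_congr rfl fun _ _ => Finset.sum_congr rfl fun _ _ => ?_
    ring
  simp_rw [Fintype.sum_prod_type, sub_mul, mul_sub, sub_mul, Finset.sum_sub_distrib]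
  rw [hdd, hdo, hod, hoo]
  ring

/-- **Kankainen's statistic (Gaussian-weighted characteristic function distance).**
For samples `x₁,…,xₙ ∈ ℝ^p`, `y₁,…,yₙ ∈ ℝ^q`, the Gaussian-weighted squared
distance between the joint empirical characteristic function and the product of
the marginal empirical characteristic functions equals
`(1/n²)∑_{j,k} k_{jk} l_{jk} − (2/n³)∑_{j,q,r} k_{jq} l_{jr}
  + (1/n⁴)(∑_{j,k} k_{jk})(∑_{q,r} l_{qr})`
with Gaussian kernels `k_{jk} = exp(−‖x_j−x_k‖²/(2σₓ²))`,
`l_{qr} = exp(−‖y_q−y_r‖²/(2σ_y²))`. -/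
theorem gaussian_weighted_ecf_distance_eq_kernel_statistic
    (p q n : ℕ) (x : Fin n → EuclideanSpace ℝ (Fin p))
    (y : Fin n → EuclideanSpace ℝ (Fin q))
    (σx σy : ℝ) (hσx : 0 < σx) (hσy : 0 < σy)
    (fXY : EuclideanSpace ℝ (Fin p) → EuclideanSpace ℝ (Fin q) → ℂ)
    (hfXY : ∀ s t, fXY s t =
      (1 / n : ℂ) * ∑ j, Complex.exp (Complex.I * ((⟪s, x j⟫ : ℝ) + (⟪t, y j⟫ : ℝ))))
    (fX : EuclideanSpace ℝ (Fin p) → ℂ)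
    (hfX : ∀ s, fX s = (1 / n : ℂ) * ∑ j, Complex.exp (Complex.I * (⟪s, x j⟫ : ℝ)))
    (fY : EuclideanSpace ℝ (Fin q) → ℂ)
    (hfY : ∀ t, fY t = (1 / n : ℂ) * ∑ j, Complex.exp (Complex.I * (⟪t, y j⟫ : ℝ)))
    (W : EuclideanSpace ℝ (Fin p) → EuclideanSpace ℝ (Fin q) → ℝ)
    (hW : ∀ s t, W s t = (σx / Real.sqrt (2 * π)) ^ p * (σy / Real.sqrt (2 * π)) ^ q *
      Real.exp (-(σx ^ 2 * ‖s‖ ^ 2) / 2) * Real.exp (-(σy ^ 2 * ‖t‖ ^ 2) / 2))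
    (K : Fin n → Fin n → ℝ) (hK : ∀ j k, K j k = Real.exp (-‖x j - x k‖ ^ 2 / (2 * σx ^ 2)))
    (L : Fin n → Fin n → ℝ) (hL : ∀ j k, L j k = Real.exp (-‖y j - y k‖ ^ 2 / (2 * σy ^ 2))) :
    (∫ t, ∫ s, ‖fXY s t - fX s * fY t‖ ^ 2 * W s t ∂volume ∂volume) =
      (1 / n ^ 2 : ℝ) * ∑ j, ∑ k, K j k * L j k
        - (2 / n ^ 3 : ℝ) * ∑ j, ∑ a, ∑ b, K j a * L j b
        + (1 / n ^ 4 : ℝ) * (∑ j, ∑ k, K j k) * (∑ a, ∑ b, L a b) := by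
  have hf (s : EuclideanSpace ℝ (Fin p)) (t : EuclideanSpace ℝ (Fin q)) :
      fXY s t - fX s * fY t = ∑ i : Fin n × Fin n,
        (((if i.1 = i.2 then 1 / (n : ℝ) else 0) - 1 / (n : ℝ) ^ 2 : ℝ) : ℂ) *
          Complex.exp (Complex.I * ((⟪s, x i.1⟫ : ℝ) + (⟪t, y i.2⟫ : ℝ))) := by
    simp_rw [Fintype.sum_prod_type, Complex.ofReal_sub, sub_mul, Finset.sum_sub_distrib]
    congr 1
    · rw [hfXY, Finset.mul_sum]
      refine Finset.sum_congr rfl fun a _ => ?_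
      rw [Finset.sum_eq_single_of_mem a (Finset.mem_univ a) fun b _ hb => by simp [hb.symm]]
      simp
    · rw [hfX, hfY, mul_mul_mul_comm, Finset.sum_mul_sum, Finset.mul_sum]
      refine Finset.sum_congr rfl fun a _ => ?_
      rw [Finset.mul_sum]
      refine Finset.sum_congr rfl fun b _ => ?_
      rw [← Complex.exp_add, ← mul_add]
      push_cast
      ring
  have hW' (s : EuclideanSpace ℝ (Fin p)) (t : EuclideanSpace ℝ (Fin q)) :
      W s t = gaussianWeight p σx s * gaussianWeight q σy t := by
    rw [hW, gaussianWeight, gaussianWeight]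
    ring
  simp_rw [hf, hW']
  rw [integral_normSq_trigSum_mul_gaussianWeight hσx hσy _ (fun i : Fin n × Fin n => x i.1)
    (fun i => y i.2)]
  simp_rw [← hK, ← hL]
  exact sum_centering_mul_kernels K L (fun j k => by rw [hK, hK, norm_sub_rev])
    fun j k => by rw [hL, hL, norm_sub_rev]
end

section
/- The Gaussian kernel is characteristic on ℝ^p: for every σ > 0, if μ and ν are Borel probability measures on ℝ^p such that ∫ exp(−‖x − y‖²/(2σ²)) dμ(y) = ∫ exp(−‖x − y‖²/(2σ²)) dν(y) for every x ∈ ℝ^p, then μ = ν. -/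
open MeasureTheory

section GaussianEmbedding

variable {V : Type*} [NormedAddCommGroup V] [InnerProductSpace ℝ V] [FiniteDimensional ℝ V]
  [MeasurableSpace V] [BorelSpace V]

/-- The function `(x, y) ↦ exp (i⟪t, x⟫) exp (-b ‖x - y‖²)` is integrable with respect to the
product of Lebesgue measure and a finite measure. -/
lemma integrable_cexp_inner_mul_gaussian_prod {b : ℝ} (hb : 0 < b) (t : V)
    (μ : Measure V) [IsFiniteMeasure μ] :
    Integrable (fun z : V × V ↦ Complex.exp (Complex.I * (inner ℝ t z.1 : ℝ)) *
      ((Real.exp (-b * ‖z.1 - z.2‖ ^ 2) : ℝ) : ℂ)) ((volume : Measure V).prod μ) := by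
  have hnorm (x y : V) : ‖Complex.exp (Complex.I * (inner ℝ t x : ℝ)) *
      ((Real.exp (-b * ‖x - y‖ ^ 2) : ℝ) : ℂ)‖ = Real.exp (-b * ‖x - y‖ ^ 2) := by
    rw [norm_mul, mul_comm Complex.I, Complex.norm_exp_ofReal_mul_I, one_mul, Complex.norm_real,
      Real.norm_of_nonneg (Real.exp_pos _).le]
  have hint : Integrable fun x : V ↦ Real.exp (-b * ‖x‖ ^ 2) := by
    simpa [Complex.norm_exp, ← Complex.ofReal_pow] using
      (GaussianFourier.integrable_cexp_neg_mul_sq_norm_add (b := (b : ℂ)) (by simpa) 0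
        (0 : V)).norm
  have hmeas : Continuous (fun z : V × V ↦ Complex.exp (Complex.I * (inner ℝ t z.1 : ℝ)) *
      ((Real.exp (-b * ‖z.1 - z.2‖ ^ 2) : ℝ) : ℂ)) := by fun_prop
  rw [integrable_prod_iff' hmeas.aestronglyMeasurable]
  refine ⟨.of_forall fun y ↦ ?_, ?_⟩
  · rw [← integrable_norm_iff (by fun_prop)]
    simp only [hnorm]
    exact hint.comp_sub_right y
  · simp only [hnorm]
    simp_rw [integral_sub_right_eq_self (μ := (volume : Measure V))
      (fun x : V ↦ Real.exp (-b * ‖x‖ ^ 2))]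
    exact integrable_const _

/-- The Fourier transform of the Gaussian mean embedding of `μ` is the characteristic function
of `μ` multiplied by the Fourier transform of the Gaussian. -/
lemma integral_cexp_inner_mul_gaussian_embedding {b : ℝ} (hb : 0 < b) (t : V)
    (μ : Measure V) [IsFiniteMeasure μ] :
    ∫ x : V, Complex.exp (Complex.I * (inner ℝ t x : ℝ)) *
        ((∫ y, Real.exp (-b * ‖x - y‖ ^ 2) ∂μ : ℝ) : ℂ) =
      charFun μ t * ∫ x : V, Complex.exp (-(b : ℂ) * ‖x‖ ^ 2 + Complex.I * (inner ℝ t x : ℝ)) := by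
  rw [charFun_apply, ← integral_mul_const]
  simp_rw [← integral_complex_ofReal, ← integral_const_mul]
  rw [integral_integral_swap (integrable_cexp_inner_mul_gaussian_prod hb t μ)]
  refine integral_congr_ae (.of_forall fun y ↦ ?_)
  beta_reduce
  rw [← integral_add_right_eq_self _ y]
  refine integral_congr_ae (.of_forall fun x ↦ ?_)
  beta_reduce
  rw [add_sub_cancel_right, Complex.ofReal_exp, ← Complex.exp_add, ← Complex.exp_add,
    inner_add_right, real_inner_comm t y]
  congr 1
  push_cast
  ring

/-- Finite measures with the same Gaussian mean embedding are equal. -/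
theorem ext_of_integral_gaussian_eq {b : ℝ} (hb : 0 < b) {μ ν : Measure V}
    [IsFiniteMeasure μ] [IsFiniteMeasure ν]
    (h : ∀ x, ∫ y, Real.exp (-b * ‖x - y‖ ^ 2) ∂μ = ∫ y, Real.exp (-b * ‖x - y‖ ^ 2) ∂ν) :
    μ = ν := by
  have hb' : 0 < (b : ℂ).re := by simpa
  refine Measure.ext_of_charFun (funext fun t ↦ ?_)
  have key := integral_cexp_inner_mul_gaussian_embedding hb t μ
  simp_rw [h] at key
  rw [integral_cexp_inner_mul_gaussian_embedding hb t ν,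
    GaussianFourier.integral_cexp_neg_mul_sq_norm_add hb'] at key
  refine (mul_right_cancel₀ (mul_ne_zero ?_ (Complex.exp_ne_zero _)) key).symm
  rw [Complex.cpow_def_of_ne_zero (div_ne_zero (by simp [Real.pi_ne_zero]) (by simpa using hb.ne'))]
  exact Complex.exp_ne_zero _

end GaussianEmbedding

/-- **The Gaussian kernel is characteristic on `ℝ^p`.**
If two Borel probability measures have the same Gaussian kernel mean
embedding `x ↦ ∫ exp(−‖x−y‖²/(2σ²)) dμ(y)`, then they are equal. -/
theorem gaussian_kernel_characteristic
    (p : ℕ) (σ : ℝ) (hσ : 0 < σ)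
    (μ ν : Measure (EuclideanSpace ℝ (Fin p)))
    [IsProbabilityMeasure μ] [IsProbabilityMeasure ν]
    (h : ∀ x, (∫ y, Real.exp (-‖x - y‖ ^ 2 / (2 * σ ^ 2)) ∂μ)
      = ∫ y, Real.exp (-‖x - y‖ ^ 2 / (2 * σ ^ 2)) ∂ν) :
    μ = ν := by
  have hexp (r : ℝ) : -(2 * σ ^ 2)⁻¹ * r ^ 2 = -r ^ 2 / (2 * σ ^ 2) := by ring
  refine ext_of_integral_gaussian_eq (b := (2 * σ ^ 2)⁻¹) (by positivity) fun x ↦ ?_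
  simpa only [hexp] using h x
end

section
/- The Laplace kernel is characteristic on ℝ^p: for every σ > 0, if μ and ν are Borel probability measures on ℝ^p such that ∫ exp(−‖x − y‖/σ) dμ(y) = ∫ exp(−‖x − y‖/σ) dν(y) for every x ∈ ℝ^p, then μ = ν. -/
open MeasureTheory

open ProbabilityTheory Set Complex
open scoped ComplexConjugate RealInnerProductSpace

section CauchySchlomilch

theorem hasDerivAt_sub_const_div {c x : ℝ} (hx : x ≠ 0) :
    HasDerivAt (fun s : ℝ => s - c / s) (1 + c / x ^ 2) x := by
  have h := (hasDerivAt_id x).sub ((hasDerivAt_inv hx).const_mul c)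
  exact h.congr_deriv (by ring)

theorem injOn_sub_const_div {c : ℝ} (hc : 0 < c) :
    InjOn (fun s : ℝ => s - c / s) (Ioi 0) := by
  intro a ha b hb hab
  simp only [mem_Ioi] at ha hb hab
  have h : (a - b) * (a * b + c) = 0 := by
    field_simp at hab
    linear_combination hab
  have : a * b + c ≠ 0 := by positivity
  have := (mul_eq_zero.mp h).resolve_right this
  linarith

theorem image_sub_const_div {c : ℝ} (hc : 0 < c) :
    (fun s : ℝ => s - c / s) '' Ioi 0 = univ := by
  refine eq_univ_of_forall fun y => ?_
  have hr : |y| < √(y ^ 2 + 4 * c) := by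
    rw [← Real.sqrt_sq_eq_abs]
    exact Real.sqrt_lt_sqrt (sq_nonneg y) (by linarith)
  have hs : √(y ^ 2 + 4 * c) ^ 2 = y ^ 2 + 4 * c := Real.sq_sqrt (by positivity)
  have hp : 0 < y + √(y ^ 2 + 4 * c) := by linarith [neg_abs_le y]
  refine ⟨(y + √(y ^ 2 + 4 * c)) / 2, by simpa using hp, ?_⟩
  field_simp
  linear_combination hs

theorem image_const_div {c : ℝ} (hc : 0 < c) : (fun s : ℝ => c / s) '' Ioi 0 = Ioi 0 := by
  ext y
  constructor
  · rintro ⟨x, hx, rfl⟩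
    exact div_pos hc hx
  · intro hy
    exact ⟨c / y, div_pos hc hy, div_div_cancel₀ hc.ne'⟩

/-- The **Cauchy–Schlömilch transformation** for even functions. -/
theorem integral_comp_sub_const_div {c : ℝ} (hc : 0 < c) {g : ℝ → ℝ} (hg : Integrable g)
    (hgm : Measurable g) (heven : ∀ x, g (-x) = g x) :
    2 * ∫ s in Ioi 0, g (s - c / s) = ∫ x, g x := by
  have hderiv : ∀ x ∈ Ioi (0 : ℝ),
      HasDerivWithinAt (fun s : ℝ => s - c / s) (1 + c / x ^ 2) (Ioi 0) x :=
    fun x hx => (hasDerivAt_sub_const_div (ne_of_gt hx)).hasDerivWithinAt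
  have hderiv' : ∀ x ∈ Ioi (0 : ℝ),
      HasDerivWithinAt (fun s : ℝ => c / s) (-(c / x ^ 2)) (Ioi 0) x := by
    intro x hx
    have h := (hasDerivAt_inv (ne_of_gt hx)).const_mul c
    exact (h.congr_deriv (by ring)).hasDerivWithinAt
  have hinj' : InjOn (fun s : ℝ => c / s) (Ioi 0) := by
    intro a _ b _ hab
    have := congrArg (fun t => c / t) hab
    simpa [div_div_cancel₀ hc.ne'] using this
  have hweight : ∀ x : ℝ, |1 + c / x ^ 2| = 1 + c / x ^ 2 := fun x => abs_of_pos (by positivity)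
  have hInt : IntegrableOn (fun s => (1 + c / s ^ 2) * g (s - c / s)) (Ioi 0) := by
    have h := (integrableOn_image_iff_integrableOn_abs_deriv_smul measurableSet_Ioi hderiv
      (injOn_sub_const_div hc) g).mp (by rw [image_sub_const_div hc]; exact hg.integrableOn)
    simpa only [hweight, smul_eq_mul] using h
  have hInt₁ : IntegrableOn (fun s => g (s - c / s)) (Ioi 0) := by
    refine Integrable.mono hInt (Measurable.aestronglyMeasurable (by fun_prop)) (ae_of_all _ fun s => ?_)
    rw [norm_mul, Real.norm_eq_abs (1 + _), hweight]
    exact le_mul_of_one_le_left (norm_nonneg _) (le_add_of_nonneg_right (by positivity))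
  have hInt₂ : IntegrableOn (fun s => c / s ^ 2 * g (s - c / s)) (Ioi 0) := by
    refine (hInt.sub hInt₁).congr (ae_of_all _ fun s => ?_)
    simp only [Pi.sub_apply]
    ring
  have hfull : ∫ x, g x = ∫ s in Ioi 0, (1 + c / s ^ 2) * g (s - c / s) := by
    have h := integral_image_eq_integral_abs_deriv_smul measurableSet_Ioi hderiv
      (injOn_sub_const_div hc) g
    rw [image_sub_const_div hc, setIntegral_univ] at h
    simpa only [hweight, smul_eq_mul] using h
  have hsymm : ∫ s in Ioi 0, g (s - c / s) = ∫ s in Ioi 0, c / s ^ 2 * g (s - c / s) := by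
    have h := integral_image_eq_integral_abs_deriv_smul measurableSet_Ioi hderiv' hinj'
      (fun s => g (s - c / s))
    rw [image_const_div hc] at h
    rw [h]
    refine setIntegral_congr_fun measurableSet_Ioi fun s _ => ?_
    have : |-(c / s ^ 2)| = c / s ^ 2 := by rw [abs_neg, abs_of_nonneg (by positivity)]
    simp only [this, smul_eq_mul, div_div_cancel₀ hc.ne']
    rw [← heven, neg_sub]
  rw [hfull, two_mul]
  nth_rewrite 2 [hsymm]
  rw [← integral_add hInt₁ hInt₂]
  exact integral_congr_ae (ae_of_all _ fun s => by ring)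

/-- The exponential function as a scale mixture of Gaussians. -/
theorem integral_exp_neg_sq_div_gaussianReal {c : ℝ} (hc : 0 ≤ c) :
    ∫ s, Real.exp (-(c / s) ^ 2 / 2) ∂gaussianReal 0 1 = Real.exp (-c) := by
  rcases hc.eq_or_lt with rfl | hc
  · simp
  have hg : Integrable (fun x : ℝ => Real.exp (-x ^ 2 / 2)) := by
    refine (integrable_exp_neg_mul_sq (b := 1 / 2) (by norm_num)).congr
      (ae_of_all _ fun x => ?_)
    ring_nf
  have hgi : ∫ x : ℝ, Real.exp (-x ^ 2 / 2) = √(2 * Real.pi) := by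
    have h := integral_gaussian (1 / 2)
    rw [show Real.pi / (1 / 2) = 2 * Real.pi by ring] at h
    rw [← h]
    refine integral_congr_ae (ae_of_all _ fun x => ?_)
    ring_nf
  have hCS := integral_comp_sub_const_div hc hg (by fun_prop) (fun x => by simp)
  have hpt : ∀ s ∈ Ioi (0 : ℝ), Real.exp (-s ^ 2 / 2) * Real.exp (-(c / s) ^ 2 / 2)
      = Real.exp (-c) * Real.exp (-(s - c / s) ^ 2 / 2) := by
    intro s hs
    have hs : s ≠ 0 := ne_of_gt hs
    rw [← Real.exp_add, ← Real.exp_add]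
    congr 1
    field_simp
    ring
  have habs : ∫ s : ℝ, Real.exp (-s ^ 2 / 2) * Real.exp (-(c / s) ^ 2 / 2)
      = 2 * ∫ s in Ioi (0 : ℝ), Real.exp (-s ^ 2 / 2) * Real.exp (-(c / s) ^ 2 / 2) := by
    rw [← integral_comp_abs (f := fun s : ℝ => Real.exp (-s ^ 2 / 2) * Real.exp (-(c / s) ^ 2 / 2))]
    simp [div_pow]
  rw [integral_gaussianReal_eq_integral_smul one_ne_zero]
  have hpdf : ∀ s : ℝ, gaussianPDFReal 0 1 s • Real.exp (-(c / s) ^ 2 / 2)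
      = (√(2 * Real.pi))⁻¹ * (Real.exp (-s ^ 2 / 2) * Real.exp (-(c / s) ^ 2 / 2)) := by
    intro s
    simp [gaussianPDFReal, mul_assoc]
  simp_rw [hpdf]
  rw [integral_const_mul, habs, setIntegral_congr_fun measurableSet_Ioi hpt, integral_const_mul,
    mul_left_comm 2, hCS, hgi]
  have : √(2 * Real.pi) ≠ 0 := by positivity
  field_simp

end CauchySchlomilch

section OpenPos

theorem isOpenPosMeasure_gaussianReal (m : ℝ) {v : NNReal} (hv : v ≠ 0) :
    (gaussianReal m v).IsOpenPosMeasure :=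
  (gaussianReal_absolutelyContinuous' m hv).isOpenPosMeasure

theorem isOpenPosMeasure_stdGaussian {ι : Type*} [Fintype ι] :
    (stdGaussian (EuclideanSpace ℝ ι)).IsOpenPosMeasure := by
  have := isOpenPosMeasure_gaussianReal 0 one_ne_zero
  rw [← map_pi_eq_stdGaussian]
  exact (PiLp.continuous_toLp 2 (fun _ : ι => ℝ)).isOpenPosMeasure_map
    (WithLp.toLp_surjective 2)

end OpenPos

section Bochner

variable {E : Type*} [NormedAddCommGroup E] [InnerProductSpace ℝ E] [MeasurableSpace E]
  [BorelSpace E] [SecondCountableTopology E]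

theorem continuous_charFun_of_isFiniteMeasure (μ : Measure E) [IsFiniteMeasure μ] :
    Continuous (charFun μ) := by
  refine continuous_of_dominated (bound := fun _ => 1)
    (fun t => by fun_prop) (fun t => ae_of_all _ fun x => ?_) (integrable_const _)
    (ae_of_all _ fun x => by fun_prop)
  rw [norm_exp_ofReal_mul_I]

theorem integral_charFun_sub (Q μ : Measure E) [IsFiniteMeasure Q] [IsFiniteMeasure μ] (x : E) :
    ∫ y, charFun Q (x - y) ∂μ = ∫ w, exp (⟪w, x⟫ * I) * charFun μ (-w) ∂Q := by
  simp only [charFun_apply]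
  rw [integral_integral_swap]
  · refine integral_congr_ae (ae_of_all _ fun w => ?_)
    simp only
    rw [← integral_const_mul]
    refine integral_congr_ae (ae_of_all _ fun y => ?_)
    simp only
    rw [← Complex.exp_add, inner_sub_right, inner_neg_right, real_inner_comm y w]
    push_cast
    ring_nf
  · refine Integrable.of_bound (Continuous.aestronglyMeasurable ?_) 1 (ae_of_all _ fun z => ?_)
    · fun_prop
    · exact (norm_exp_ofReal_mul_I _).le

theorem integral_integral_charFun_sub (Q ρ μ : Measure E) [IsFiniteMeasure Q] [IsFiniteMeasure ρ]
    [IsFiniteMeasure μ] :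
    ∫ x, ∫ y, charFun Q (x - y) ∂μ ∂ρ = ∫ w, charFun ρ w * conj (charFun μ w) ∂Q := by
  have hμ := continuous_charFun_of_isFiniteMeasure μ
  simp only [integral_charFun_sub]
  rw [integral_integral_swap]
  · refine integral_congr_ae (ae_of_all _ fun w => ?_)
    simp only
    rw [integral_mul_const, charFun_neg, charFun_apply (μ := ρ)]
    simp only [real_inner_comm]
  · refine Integrable.of_bound (Continuous.aestronglyMeasurable ?_) (μ.real univ)
      (ae_of_all _ fun z => ?_)
    · fun_prop
    · simp only [Function.uncurry, norm_mul, norm_exp_ofReal_mul_I, one_mul]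
      exact norm_charFun_le _

/-- The translation-invariant kernel given by the characteristic function of a measure of full
support is characteristic. -/
theorem measure_eq_of_integral_charFun_sub [CompleteSpace E] (Q μ ν : Measure E)
    [IsFiniteMeasure Q] [Q.IsOpenPosMeasure] [IsFiniteMeasure μ] [IsFiniteMeasure ν]
    (h : ∀ x, ∫ y, charFun Q (x - y) ∂μ = ∫ y, charFun Q (x - y) ∂ν) : μ = ν := by
  have hμ := continuous_charFun_of_isFiniteMeasure μ
  have hν := continuous_charFun_of_isFiniteMeasure ν
  have hInt : ∀ (ρ τ : Measure E) [IsFiniteMeasure ρ] [IsFiniteMeasure τ],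
      Integrable (fun w => charFun ρ w * conj (charFun τ w)) Q := by
    intro ρ τ _ _
    have hρ := continuous_charFun_of_isFiniteMeasure ρ
    have hτ := continuous_charFun_of_isFiniteMeasure τ
    refine Integrable.of_bound (Continuous.aestronglyMeasurable ?_)
      (ρ.real univ * τ.real univ) (ae_of_all _ fun z => ?_)
    · exact hρ.mul (continuous_conj.comp hτ)
    · rw [norm_mul, RCLike.norm_conj]
      gcongr <;> exact norm_charFun_le _
  have key : ∀ (ρ : Measure E) [IsFiniteMeasure ρ],
      ∫ w, charFun ρ w * conj (charFun μ w) ∂Q = ∫ w, charFun ρ w * conj (charFun ν w) ∂Q := by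
    intro ρ _
    rw [← integral_integral_charFun_sub, ← integral_integral_charFun_sub]
    simp only [h]
  have hsq : ∀ w, ((‖charFun μ w - charFun ν w‖ ^ 2 : ℝ) : ℂ)
      = (charFun μ w * conj (charFun μ w) - charFun μ w * conj (charFun ν w))
        - (charFun ν w * conj (charFun μ w) - charFun ν w * conj (charFun ν w)) := by
    intro w
    push_cast
    rw [← Complex.mul_conj', map_sub]
    ring
  have hzero : ∫ w, ‖charFun μ w - charFun ν w‖ ^ 2 ∂Q = 0 := by
    rw [← Complex.ofReal_eq_zero, ← integral_complex_ofReal]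
    simp only [hsq]
    refine (integral_sub ((hInt μ μ).sub (hInt μ ν)) ((hInt ν μ).sub (hInt ν ν))).trans ?_
    simp only [Pi.sub_apply]
    rw [integral_sub (hInt μ μ) (hInt μ ν), integral_sub (hInt ν μ) (hInt ν ν), key μ, key ν]
    ring
  have hIntSq : Integrable (fun w => ‖charFun μ w - charFun ν w‖ ^ 2) Q := by
    have h := ((hInt μ μ).sub (hInt μ ν)).sub ((hInt ν μ).sub (hInt ν ν))
    refine h.re.congr (ae_of_all _ fun w => ?_)
    have := congrArg Complex.re (hsq w)
    rw [Complex.ofReal_re] at this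
    exact this.symm
  rw [integral_eq_zero_iff_of_nonneg (fun w => by positivity) hIntSq] at hzero
  have hfun := (Continuous.ae_eq_iff_eq Q (by fun_prop) continuous_zero).mp hzero
  refine Measure.ext_of_charFun (funext fun w => ?_)
  have := congrFun hfun w
  simpa [sub_eq_zero] using this

end Bochner

section MultivariateCauchy

/-- The law of `v / (σ s)` for independent standard Gaussians `s` on `ℝ` and `v` on `ℝ^ι`: the
spherically symmetric Cauchy distribution of scale `σ⁻¹`. -/
noncomputable def multivariateCauchy (ι : Type*) [Fintype ι] (σ : ℝ) :
    Measure (EuclideanSpace ℝ ι) :=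
  ((gaussianReal 0 1).prod (stdGaussian (EuclideanSpace ℝ ι))).map
    fun z => (σ * z.1)⁻¹ • z.2

variable {ι : Type*} [Fintype ι] {σ : ℝ}

instance isProbabilityMeasure_multivariateCauchy :
    IsProbabilityMeasure (multivariateCauchy ι σ) :=
  Measure.isProbabilityMeasure_map (by fun_prop)

theorem isOpenPosMeasure_multivariateCauchy (hσ : 0 < σ) :
    (multivariateCauchy ι σ).IsOpenPosMeasure := by
  have := isOpenPosMeasure_gaussianReal 0 one_ne_zero
  have := isOpenPosMeasure_stdGaussian (ι := ι)
  refine ⟨fun U hU ⟨u, hu⟩ => ?_⟩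
  rw [multivariateCauchy, Measure.map_apply (by fun_prop) hU.measurableSet]
  have hcont : ContinuousOn (fun z : ℝ × EuclideanSpace ℝ ι => (σ * z.1)⁻¹ • z.2)
      {z | z.1 ≠ 0} := by
    exact ((continuousOn_fst.const_mul σ).inv₀ fun z hz => mul_ne_zero hσ.ne' hz).smul
      continuousOn_snd
  have hopen := hcont.isOpen_inter_preimage
    (isOpen_ne_fun continuous_fst continuous_const) hU
  have hne := hopen.measure_ne_zero ((gaussianReal 0 1).prod (stdGaussian (EuclideanSpace ℝ ι)))
    ⟨(σ⁻¹, u), by simp [hσ.ne', hu]⟩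
  exact fun h => hne (measure_mono_null inter_subset_right h)

theorem charFun_multivariateCauchy (hσ : 0 < σ) (t : EuclideanSpace ℝ ι) :
    charFun (multivariateCauchy ι σ) t = Real.exp (-‖t‖ / σ) := by
  rw [charFun_apply, multivariateCauchy, integral_map (by fun_prop) (by fun_prop),
    integral_prod]
  · have hinner : ∀ s : ℝ, ∫ v, exp (⟪(σ * s)⁻¹ • v, t⟫ * I) ∂stdGaussian (EuclideanSpace ℝ ι)
        = (Real.exp (-(‖t‖ / σ / s) ^ 2 / 2) : ℝ) := by
      intro s
      have h := charFun_stdGaussian ((σ * s)⁻¹ • t)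
      rw [charFun_apply] at h
      simp only [inner_smul_left, inner_smul_right] at h ⊢
      simp only [conj_trivial]
      rw [h, norm_smul, Real.norm_eq_abs, ← Complex.ofReal_pow, mul_pow, sq_abs]
      push_cast
      congr 1
      field_simp
    simp only [hinner]
    rw [integral_complex_ofReal, integral_exp_neg_sq_div_gaussianReal (by positivity), neg_div]
  · refine Integrable.of_bound (Measurable.aestronglyMeasurable ?_) 1 (ae_of_all _ fun z => ?_)
    · fun_prop
    · exact (norm_exp_ofReal_mul_I _).le

end MultivariateCauchy

/-- **The Laplace kernel is characteristic on `ℝ^p`.**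
If two Borel probability measures have the same Laplace kernel mean
embedding `x ↦ ∫ exp(−‖x−y‖/σ) dμ(y)`, then they are equal. -/
theorem laplace_kernel_characteristic
    (p : ℕ) (σ : ℝ) (hσ : 0 < σ)
    (μ ν : Measure (EuclideanSpace ℝ (Fin p)))
    [IsProbabilityMeasure μ] [IsProbabilityMeasure ν]
    (h : ∀ x, (∫ y, Real.exp (-‖x - y‖ / σ) ∂μ)
      = ∫ y, Real.exp (-‖x - y‖ / σ) ∂ν) :
    μ = ν := by
  have := isOpenPosMeasure_multivariateCauchy (ι := Fin p) hσ
  refine measure_eq_of_integral_charFun_sub (multivariateCauchy (Fin p) σ) μ ν fun x => ?_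
  simp only [charFun_multivariateCauchy hσ]
  rw [integral_complex_ofReal, integral_complex_ofReal, h x]
end

section
/- Let Λ be a finite nonzero nonnegative Borel measure on ℝ^p and let λ(z) = ∫_{ℝ^p} e^{-i⟨z,u⟩} dΛ(u) be real-valued (equivalently, Λ is symmetric), so that k(x,y) = λ(x − y) is a bounded continuous translation-invariant positive definite kernel. Then k is characteristic — i.e., the map sending a Borel probability measure μ on ℝ^p to the function x ↦ ∫ λ(x − y) dμ(y) is injective — if and only if the support of Λ is all of ℝ^p. -/
open MeasureTheory Complex
open scoped RealInnerProductSpace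

section FourierKernel

open scoped FourierTransform ComplexConjugate

lemma charFun_eq_integral_exp_mul_inner {E : Type*} [NormedAddCommGroup E]
    [InnerProductSpace ℝ E] [MeasurableSpace E] (μ : Measure E) (t : E) :
    charFun μ t = ∫ y, cexp (I * (⟪y, t⟫ : ℝ)) ∂μ := by
  simp only [charFun_apply, mul_comm]

lemma conj_charFun_eq_integral_exp_neg_mul_inner {E : Type*} [NormedAddCommGroup E]
    [InnerProductSpace ℝ E] [MeasurableSpace E] (μ : Measure E) (t : E) :
    conj (charFun μ t) = ∫ y, cexp (-I * (⟪y, t⟫ : ℝ)) ∂μ := by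
  rw [← charFun_neg]
  simp [charFun_apply, mul_comm]

variable {E : Type*} [NormedAddCommGroup E] [InnerProductSpace ℝ E] [MeasurableSpace E]
  [BorelSpace E] [SecondCountableTopology E]

/-- Fubini for an integrable function against the Fourier characters and a finite measure. -/
lemma integral_mul_integral_exp_inner_swap {α Λ : Measure E} [SFinite α] [IsFiniteMeasure Λ]
    {F : E → ℂ} (hF : Integrable F α) {G : E → ℂ} (hG : Integrable G Λ) (c : ℂ) (hc : c.re = 0) :
    ∫ y, F y * ∫ u, cexp (c * (⟪y, u⟫ : ℝ)) * G u ∂Λ ∂α =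
      ∫ u, (∫ y, F y * cexp (c * (⟪y, u⟫ : ℝ)) ∂α) * G u ∂Λ := by
  have hint : Integrable (fun q : E × E ↦ cexp (c * (⟪q.1, q.2⟫ : ℝ)) * (F q.1 * G q.2))
      (α.prod Λ) := by
    refine (hF.mul_prod hG).bdd_mul (c := 1) ?_ (.of_forall fun q ↦ ?_)
    · exact Continuous.aestronglyMeasurable (by fun_prop)
    · simp [Complex.norm_exp, hc]
  calc _ = ∫ y, ∫ u, cexp (c * (⟪y, u⟫ : ℝ)) * (F y * G u) ∂Λ ∂α := by
        refine integral_congr_ae (.of_forall fun y ↦ ?_)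
        simp only [← integral_const_mul]
        exact integral_congr_ae (.of_forall fun u ↦ by ring)
    _ = ∫ u, ∫ y, cexp (c * (⟪y, u⟫ : ℝ)) * (F y * G u) ∂α ∂Λ := integral_integral_swap hint
    _ = _ := by
        refine integral_congr_ae (.of_forall fun u ↦ ?_)
        simp only [← integral_mul_const]
        exact integral_congr_ae (.of_forall fun u ↦ by ring)

/-- Convolving an integrable function with the Fourier transform of `Λ` multiplies `Λ` by the
inverse Fourier transform of the function. -/
lemma integral_mul_fourier_sub {α Λ : Measure E} [SFinite α] [IsFiniteMeasure Λ] {lam : E → ℝ}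
    (hlam : ∀ z, (lam z : ℂ) = ∫ u, cexp (-I * (⟪z, u⟫ : ℝ)) ∂Λ)
    {F : E → ℂ} (hF : Integrable F α) (x : E) :
    ∫ y, F y * lam (x - y) ∂α =
      ∫ u, (∫ y, F y * cexp (I * (⟪y, u⟫ : ℝ)) ∂α) * cexp (-I * (⟪x, u⟫ : ℝ)) ∂Λ := by
  rw [← integral_mul_integral_exp_inner_swap hF _ I I_re]
  · refine integral_congr_ae (.of_forall fun y ↦ ?_)
    simp only [hlam, ← Complex.exp_add]
    congr! 4 with u
    rw [inner_sub_left]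
    push_cast
    ring
  · refine (integrable_const (1 : ℂ)).mono (Continuous.aestronglyMeasurable (by fun_prop))
      (.of_forall fun q ↦ ?_)
    simp [Complex.norm_exp]

/-- The double integral of `lam (x - y)` in terms of characteristic functions. -/
lemma integral_integral_fourier_sub {α μ Λ : Measure E} [IsFiniteMeasure α] [IsFiniteMeasure μ]
    [IsFiniteMeasure Λ] {lam : E → ℝ}
    (hlam : ∀ z, (lam z : ℂ) = ∫ u, cexp (-I * (⟪z, u⟫ : ℝ)) ∂Λ) :
    ((∫ x, ∫ y, lam (x - y) ∂μ ∂α : ℝ) : ℂ) = ∫ u, conj (charFun α u) * charFun μ u ∂Λ := by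
  have hG : Integrable (charFun μ) Λ :=
    (integrable_const (μ.real Set.univ)).mono continuous_charFun.aestronglyMeasurable
      (.of_forall fun u ↦ (norm_charFun_le u).trans (le_abs_self _))
  have h := integral_mul_integral_exp_inner_swap (integrable_const (1 : ℂ)) hG (-I)
    (by simp) (α := α)
  simp only [one_mul, ← conj_charFun_eq_integral_exp_neg_mul_inner] at h
  rw [← h, ← integral_complex_ofReal]
  refine integral_congr_ae (.of_forall fun x ↦ ?_)
  have h2 := integral_mul_fourier_sub hlam (integrable_const (1 : ℂ)) x (α := μ)
  simp only [one_mul, ← charFun_eq_integral_exp_mul_inner] at h2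
  simp only [← integral_complex_ofReal, h2, mul_comm]

/-- Finite measures with the same mean embedding have the same characteristic function almost
everywhere with respect to the spectral measure `Λ` of the kernel. -/
lemma charFun_ae_eq_of_integral_fourier_sub_eq {μ ν Λ : Measure E} [IsFiniteMeasure μ]
    [IsFiniteMeasure ν] [IsFiniteMeasure Λ] {lam : E → ℝ}
    (hlam : ∀ z, (lam z : ℂ) = ∫ u, cexp (-I * (⟪z, u⟫ : ℝ)) ∂Λ)
    (h : ∀ x, ∫ y, lam (x - y) ∂μ = ∫ y, lam (x - y) ∂ν) :
    charFun μ =ᵐ[Λ] charFun ν := by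
  have hbdd (α β : Measure E) [IsFiniteMeasure α] [IsFiniteMeasure β] :
      Integrable (fun u ↦ conj (charFun α u) * charFun β u) Λ := by
    refine (integrable_const (α.real Set.univ * β.real Set.univ)).mono
      (Continuous.aestronglyMeasurable ?_) (.of_forall fun u ↦ ?_)
    · exact (Complex.continuous_conj.comp continuous_charFun).mul continuous_charFun
    · rw [norm_mul, RCLike.norm_conj, norm_mul]
      gcongr
      · exact (norm_charFun_le u).trans (le_abs_self _)
      · exact (norm_charFun_le u).trans (le_abs_self _)
  have hα (α : Measure E) [IsFiniteMeasure α] :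
      ∫ u, conj (charFun α u) * charFun μ u ∂Λ = ∫ u, conj (charFun α u) * charFun ν u ∂Λ := by
    rw [← integral_integral_fourier_sub hlam, ← integral_integral_fourier_sub hlam]
    simp only [h]
  have hsq (u : E) : ((‖charFun μ u - charFun ν u‖ ^ 2 : ℝ) : ℂ) =
      (conj (charFun μ u) * charFun μ u - conj (charFun μ u) * charFun ν u) -
        (conj (charFun ν u) * charFun μ u - conj (charFun ν u) * charFun ν u) := by
    push_cast
    rw [← Complex.conj_mul', map_sub]
    ring
  have hzero : ∫ u, ‖charFun μ u - charFun ν u‖ ^ 2 ∂Λ = 0 := by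
    have : ((∫ u, ‖charFun μ u - charFun ν u‖ ^ 2 ∂Λ : ℝ) : ℂ) = 0 := by
      rw [← integral_complex_ofReal]
      simp only [hsq]
      rw [integral_sub (by exact (hbdd _ _).sub (hbdd _ _)) (by exact (hbdd _ _).sub (hbdd _ _)),
        integral_sub (hbdd _ _) (hbdd _ _), integral_sub (hbdd _ _) (hbdd _ _), hα μ, hα ν]
      simp
    exact_mod_cast this
  have hint : Integrable (fun u ↦ ‖charFun μ u - charFun ν u‖ ^ 2) Λ := by
    refine (integrable_const ((μ.real Set.univ + ν.real Set.univ) ^ 2)).mono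
      (Continuous.aestronglyMeasurable ?_) (.of_forall fun u ↦ ?_)
    · exact (continuous_charFun.sub continuous_charFun).norm.pow 2
    · rw [norm_pow, norm_norm, norm_pow]
      gcongr
      rw [Real.norm_of_nonneg (by positivity)]
      exact (norm_sub_le _ _).trans (add_le_add (norm_charFun_le u) (norm_charFun_le u))
  rw [integral_eq_zero_iff_of_nonneg (fun u ↦ by positivity) hint] at hzero
  filter_upwards [hzero] with u hu
  simpa [sub_eq_zero] using hu

end FourierKernel

section CharacteristicKernel

/-- If a bounded kernel separates probability measures, then it separates integrable densities of
total mass zero from the zero density. -/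
lemma ae_eq_zero_of_integral_mul_kernel_eq_zero {X : Type*} [MeasurableSpace X] {ρ : Measure X}
    {k : X → X → ℝ} (hk : ∀ x, Measurable (k x)) {B : ℝ} (hB : ∀ x y, |k x y| ≤ B)
    (hchar : ∀ μ ν : Measure X, IsProbabilityMeasure μ → IsProbabilityMeasure ν →
      (∀ x, ∫ y, k x y ∂μ = ∫ y, k x y ∂ν) → μ = ν)
    {f : X → ℝ} (hfm : Measurable f) (hf : Integrable f ρ) (hf0 : ∫ y, f y ∂ρ = 0)
    (hfk : ∀ x, ∫ y, f y * k x y ∂ρ = 0) : f =ᵐ[ρ] 0 := by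
  set P := ρ.withDensity fun x ↦ ENNReal.ofReal (f x) with hP
  set N := ρ.withDensity fun x ↦ ENNReal.ofReal (-f x) with hN
  have hPfin : IsFiniteMeasure P := isFiniteMeasure_withDensity_ofReal hf.2
  have hNfin : IsFiniteMeasure N := isFiniteMeasure_withDensity_ofReal hf.neg.2
  have hmass : P Set.univ = N Set.univ := by
    rw [← ENNReal.toReal_eq_toReal_iff' (measure_ne_top _ _) (measure_ne_top _ _),
      ← sub_eq_zero, ← hf0, integral_eq_lintegral_pos_part_sub_lintegral_neg_part hf]
    simp [P, N]
  have hPN : ∀ x, ∫ y, k x y ∂P = ∫ y, k x y ∂N := by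
    intro x
    rw [hP, hN, integral_withDensity_eq_integral_toReal_smul (by fun_prop) (by simp),
      integral_withDensity_eq_integral_toReal_smul (by fun_prop) (by simp), ← sub_eq_zero,
      ← integral_sub, ← hfk x]
    · refine integral_congr_ae (.of_forall fun y ↦ ?_)
      simp only [smul_eq_mul, ← sub_mul, ENNReal.toReal_ofReal']
      rw [max_zero_sub_eq_self]
    · exact (hf.real_toNNReal).mul_bdd (hk x).aestronglyMeasurable (.of_forall (hB x))
    · exact (hf.neg.real_toNNReal).mul_bdd (hk x).aestronglyMeasurable (.of_forall (hB x))
  have hPeqN : P = N := by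
    by_cases hm : P Set.univ = 0
    · exact (Measure.measure_univ_eq_zero.1 hm).trans
        (Measure.measure_univ_eq_zero.1 (hmass ▸ hm)).symm
    · have hmt : P Set.univ ≠ ⊤ := measure_ne_top _ _
      have key := hchar ((P Set.univ)⁻¹ • P) ((P Set.univ)⁻¹ • N)
        ⟨by simp [ENNReal.inv_mul_cancel hm hmt]⟩
        ⟨by simp [← hmass, ENNReal.inv_mul_cancel hm hmt]⟩
        (fun x ↦ by rw [integral_smul_measure, integral_smul_measure, hPN])
      have := congrArg (fun m ↦ P Set.univ • m) key
      simpa [smul_smul, ENNReal.mul_inv_cancel hm hmt] using this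
  have hfin : ∫⁻ x, ENNReal.ofReal (f x) ∂ρ ≠ ⊤ := by
    simpa [P] using measure_ne_top P Set.univ
  filter_upwards [(withDensity_eq_iff (by fun_prop) (by fun_prop) hfin).1 hPeqN] with x hx
  have h := congrArg ENNReal.toReal hx
  simp only [ENNReal.toReal_ofReal'] at h
  rw [← max_zero_sub_eq_self (f x), h, sub_self, Pi.zero_apply]

end CharacteristicKernel

section SpectralSupport

open scoped FourierTransform ComplexConjugate SchwartzMap

variable {E : Type*} [NormedAddCommGroup E] [InnerProductSpace ℝ E] [MeasurableSpace E]
  [BorelSpace E] [FiniteDimensional ℝ E]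

/-- Off any proper closed set there is room for the spectrum of a Schwartz function with nonzero
real part and vanishing integral. -/
lemma exists_schwartz_re_ne_zero_integral_exp_eq_zero [Nontrivial E] {C : Set E}
    (hC : IsClosed C) (hne : C ≠ Set.univ) :
    ∃ F : 𝓢(E, ℂ), (∃ y, (F y).re ≠ 0) ∧ ∫ y, F y = 0 ∧
      ∀ u ∈ C, ∫ y, F y * cexp (I * (⟪y, u⟫ : ℝ)) = 0 := by
  have hπ : (-(2 * Real.pi)) ≠ 0 := by simp [Real.pi_ne_zero]
  obtain ⟨v, hvC, hv0⟩ : (Cᶜ ∩ {0}ᶜ).Nonempty :=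
    (dense_compl_singleton (0 : E)).inter_open_nonempty _ hC.isOpen_compl
      (Set.nonempty_compl.2 hne)
  set w : E := (-(2 * Real.pi))⁻¹ • v
  have hwv : (-(2 * Real.pi)) • w = v := smul_inv_smul₀ hπ v
  have hw0 : w ≠ 0 := fun h ↦ hv0 (by simp [← hwv, h])
  have hs : {x : E | (-(2 * Real.pi)) • x ∉ C} ∩ {0}ᶜ ∩ {-w}ᶜ ∈ nhds w := by
    refine Filter.inter_mem (Filter.inter_mem ?_ ?_) ?_
    · exact (hC.isOpen_compl.preimage (continuous_const_smul _)).mem_nhds (by rwa [Set.mem_preimage, hwv])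
    · exact isOpen_compl_singleton.mem_nhds hw0
    · exact isOpen_compl_singleton.mem_nhds fun h ↦ hw0 (by
        simpa [← two_smul ℝ w] using eq_neg_iff_add_eq_zero.1 h)
  obtain ⟨b, hbs, hbc, hbd, -, hbw⟩ := exists_contDiff_tsupport_subset (n := ⊤) hs
  have hb0 (x : E) (hx : x ∉ {x : E | (-(2 * Real.pi)) • x ∉ C} ∩ {0}ᶜ ∩ {-w}ᶜ) : b x = 0 :=
    image_eq_zero_of_notMem_tsupport fun h ↦ hx (hbs h)
  let g : 𝓢(E, ℂ) := (hbc.comp_left (g := ((↑) : ℝ → ℂ)) (by simp)).toSchwartzMap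
    (Complex.ofRealCLM.contDiff.comp hbd)
  have hg (x : E) : g x = b x := rfl
  let F : 𝓢(E, ℂ) := 𝓕⁻ g
  have hF (x : E) : ∫ y, cexp ((-(2 * Real.pi) * ⟪y, x⟫ : ℝ) * I) * F y = b x := by
    rw [← hg, ← FourierTransform.fourier_fourierInv_eq (F := 𝓢(E, ℂ)) g, SchwartzMap.fourier_coe, Real.fourier_eq']
    simp [F]
  refine ⟨F, ?_, ?_, fun u hu ↦ ?_⟩
  · by_contra! hre
    have hconj (y : E) : conj (F y) = -F y := by
      apply Complex.ext <;> simp [hre y]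
    have h1 : conj (b (-w) : ℂ) = -(b w : ℂ) := by
      rw [← hF, ← hF, ← integral_conj, ← integral_neg]
      refine integral_congr_ae (.of_forall fun y ↦ ?_)
      simp [hconj, ← Complex.exp_conj, Complex.conj_ofNat]
    rw [hb0 (-w) (by simp), hbw] at h1
    simp at h1
  · have := hF 0
    rw [hb0 0 (by simp)] at this
    simpa using this
  · have := hF ((-(2 * Real.pi))⁻¹ • u)
    rw [hb0 _ (fun h ↦ h.1.1 (by rwa [smul_inv_smul₀ hπ])), Complex.ofReal_zero] at this
    rw [← this]
    refine integral_congr_ae (.of_forall fun y ↦ ?_)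
    simp only [inner_smul_right, mul_inv_cancel_left₀ hπ]
    ring_nf

/-- The spectral measure of a characteristic translation-invariant kernel charges every nonempty
open set. -/
lemma eq_univ_of_characteristic_fourier_kernel [Nontrivial E] {Λ : Measure E} [IsFiniteMeasure Λ]
    {lam : E → ℝ} (hlam : ∀ z, (lam z : ℂ) = ∫ u, cexp (-I * (⟪z, u⟫ : ℝ)) ∂Λ)
    (hchar : ∀ μ ν : Measure E, IsProbabilityMeasure μ → IsProbabilityMeasure ν →
      (∀ x, ∫ y, lam (x - y) ∂μ = ∫ y, lam (x - y) ∂ν) → μ = ν)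
    {C : Set E} (hC : IsClosed C) (hΛC : Λ Cᶜ = 0) : C = Set.univ := by
  by_contra hne
  obtain ⟨F, ⟨y₀, hy₀⟩, hF0, hFC⟩ := exists_schwartz_re_ne_zero_integral_exp_eq_zero hC hne
  have hFint : Integrable F := F.integrable
  have hconj (z : E) : (lam z : ℂ) = conj (charFun Λ z) := by
    rw [hlam, conj_charFun_eq_integral_exp_neg_mul_inner]
    simp only [real_inner_comm]
  have hlam_cont : Continuous lam := by
    have : lam = fun z ↦ (conj (charFun Λ z)).re := by
      ext z
      rw [← hconj, ofReal_re]
    rw [this]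
    exact Complex.continuous_re.comp (Complex.continuous_conj.comp continuous_charFun)
  have hlam_bdd (z : E) : |lam z| ≤ Λ.real Set.univ := by
    rw [← Real.norm_eq_abs, ← Complex.norm_real, hconj, RCLike.norm_conj]
    exact norm_charFun_le z
  have hFcont : Continuous fun y ↦ (F y).re := Complex.continuous_re.comp F.continuous
  have hae : (fun y ↦ (F y).re) =ᵐ[volume] 0 := by
    refine ae_eq_zero_of_integral_mul_kernel_eq_zero (k := fun x y ↦ lam (x - y))
      (fun x ↦ Continuous.measurable (by fun_prop)) (fun x y ↦ hlam_bdd _) hchar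
      hFcont.measurable hFint.re ?_ fun x ↦ ?_
    · have := integral_re hFint
      simpa [hF0] using this
    · have hint : Integrable fun y ↦ F y * (lam (x - y) : ℂ) := by
        refine hFint.mul_bdd (c := Λ.real Set.univ)
          (Continuous.aestronglyMeasurable (by fun_prop)) (.of_forall fun y ↦ ?_)
        simpa using hlam_bdd (x - y)
      have hz : ∫ y, F y * (lam (x - y) : ℂ) = 0 := by
        rw [integral_mul_fourier_sub hlam hFint]
        refine integral_eq_zero_of_ae ?_
        filter_upwards [measure_eq_zero_iff_ae_notMem.1 hΛC] with u hu
        simp [hFC u (not_not.1 hu)]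
      have := integral_re hint
      simpa [hz] using this
  exact hy₀ (congrFun ((hFcont.ae_eq_iff_eq volume continuous_zero).1 hae) y₀)

end SpectralSupport

/-- **Characteristic translation-invariant kernels (Sriperumbudur et al.).**
Let `Λ` be a finite nonzero nonnegative Borel measure on `ℝ^p` whose Fourier
transform `λ(z) = ∫ e^{-i⟨z,u⟩} dΛ(u)` is real-valued, so `k(x,y) = λ(x−y)` is
a bounded continuous translation-invariant positive definite kernel.  Then `k`
is characteristic (the kernel mean embedding `μ ↦ (x ↦ ∫ λ(x−y) dμ(y))` is
injective on Borel probability measures) if and only if the support of `Λ` is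
all of `ℝ^p`, i.e. every closed set whose complement is `Λ`-null is `ℝ^p`
itself. -/
theorem translation_invariant_kernel_characteristic_iff_support_eq_univ
    (p : ℕ) (Λ : Measure (EuclideanSpace ℝ (Fin p))) [IsFiniteMeasure Λ]
    (hΛ : Λ ≠ 0)
    (lam : EuclideanSpace ℝ (Fin p) → ℝ)
    (hlam : ∀ z, (lam z : ℂ) = ∫ u, Complex.exp (-Complex.I * (⟪z, u⟫ : ℝ)) ∂Λ) :
    (∀ μ ν : Measure (EuclideanSpace ℝ (Fin p)),
        IsProbabilityMeasure μ → IsProbabilityMeasure ν →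
        (∀ x, (∫ y, lam (x - y) ∂μ) = ∫ y, lam (x - y) ∂ν) → μ = ν) ↔
      ∀ C : Set (EuclideanSpace ℝ (Fin p)), IsClosed C → Λ Cᶜ = 0 → C = Set.univ := by
  refine ⟨fun hchar C hC hΛC ↦ ?_, fun hsupp μ ν hμ hν h ↦ ?_⟩
  · cases subsingleton_or_nontrivial (EuclideanSpace ℝ (Fin p))
    · refine Set.Nonempty.eq_univ (Set.nonempty_iff_ne_empty.2 fun hemp ↦ hΛ ?_)
      simpa [hemp] using hΛC
    · exact eq_univ_of_characteristic_fourier_kernel hlam hchar hC hΛC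
  · refine Measure.ext_of_charFun (funext fun u ↦ ?_)
    have huniv := hsupp {u | charFun μ u = charFun ν u}
      (isClosed_eq continuous_charFun continuous_charFun)
      (charFun_ae_eq_of_integral_fourier_sub_eq hlam h)
    exact huniv.ge (Set.mem_univ u)
end

section
/- Universal kernels are characteristic on compact domains: let K be a compact metric space and k : K × K → ℝ a continuous kernel such that the linear span of the functions {k(x,·) : x ∈ K} is dense in the space C(K) of continuous real-valued functions on K with the supremum norm. If μ and ν are Borel probability measures on K with ∫ k(x,y) dμ(y) = ∫ k(x,y) dν(y) for every x ∈ K, then μ = ν. -/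
open MeasureTheory

/-- Integration against a finite measure on a compact space, as a continuous linear functional
on the continuous functions. -/
noncomputable def integralFunctional {K : Type*} [TopologicalSpace K] [CompactSpace K]
    [MeasurableSpace K] [BorelSpace K] (μ : Measure K) [IsFiniteMeasure μ] :
    C(K, ℝ) →L[ℝ] ℝ :=
  have integrable (f : C(K, ℝ)) : Integrable f μ :=
    (BoundedContinuousFunction.mkOfCompact f).integrable μ
  LinearMap.mkContinuous
    { toFun f := ∫ y, f y ∂μ
      map_add' f g := integral_add (integrable f) (integrable g)
      map_smul' c f := integral_const_mul c f }
    (μ.real Set.univ)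
    fun f => (norm_integral_le_of_norm_le_const (.of_forall f.norm_coe_le_norm)).trans_eq
      (mul_comm _ _)

/-- **Universal kernels are characteristic on compact domains.**
Let `K` be a compact metric space and `k` a continuous kernel on `K` such that
the linear span of the slices `{k(x,·) : x ∈ K}` is dense in `C(K, ℝ)` (with
the supremum norm, which induces the topology of `C(K, ℝ)` since `K` is
compact).  If two Borel probability measures have the same kernel mean
embedding `x ↦ ∫ k(x,y) dμ(y)`, then they are equal. -/
theorem universal_kernel_characteristic
    (K : Type*) [MetricSpace K] [CompactSpace K]
    [MeasurableSpace K] [BorelSpace K]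
    (k : C(K × K, ℝ))
    (huniv : Dense ((Submodule.span ℝ
      (Set.range fun x : K => k.curry x) : Submodule ℝ C(K, ℝ)) : Set C(K, ℝ)))
    (μ ν : Measure K) [IsProbabilityMeasure μ] [IsProbabilityMeasure ν]
    (h : ∀ x, (∫ y, k (x, y) ∂μ) = ∫ y, k (x, y) ∂ν) :
    μ = ν := by
  have heq : integralFunctional μ = integralFunctional ν :=
    ContinuousLinearMap.ext_on huniv <| by
      rintro _ ⟨x, rfl⟩
      exact h x
  refine ext_of_forall_integral_eq_of_IsFiniteMeasure fun f => ?_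
  exact DFunLike.congr_fun heq f.toContinuousMap
end

section
/- The exponential inner-product kernel is universal on compact subsets of ℝ^p: for every σ > 0 and every compact set K ⊆ ℝ^p, the linear span of the functions {x ↦ exp(⟨x,y⟩/σ) : y ∈ K} is dense in the space C(K) of continuous real-valued functions on K with the supremum norm. -/
open scoped RealInnerProductSpace

open scoped Nat in
/-- The section at `y` of the kernel `(x, y) ↦ exp (∑ i, e i x * e i y)`, expanded in `C(X, ℝ)`
as a power series in monomials of the features `e i`. -/
theorem ContinuousMap.hasSum_exp_sum_smul {X ι : Type*} [TopologicalSpace X] [CompactSpace X]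
    [Fintype ι] (e : ι → C(X, ℝ)) (y : X) :
    HasSum (fun n : ℕ => (n ! : ℝ)⁻¹ • ∑ w : Fin n → ι, (∏ j, e (w j)) y • ∏ j, e (w j))
      (NormedSpace.exp (∑ i, e i y • e i)) := by
  refine (NormedSpace.exp_series_hasSum_exp' (𝕂 := ℝ) (∑ i, e i y • e i)).congr_fun fun n => ?_
  rw [Fintype.sum_pow]
  congr 1
  refine Finset.sum_congr rfl fun w _ => ?_
  ext x
  simp [ContinuousMap.prod_apply, Finset.prod_mul_distrib]

theorem ContinuousMap.exp_apply {X : Type*} [TopologicalSpace X] [CompactSpace X]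
    (g : C(X, ℝ)) (x : X) : NormedSpace.exp g x = Real.exp (g x) := by
  rw [Real.exp_eq_exp_ℝ]
  exact NormedSpace.map_exp
    (ContinuousMap.evalAlgHom ℝ ℝ x) (continuous_eval_const x) g

theorem ContinuousMap.norm_prod_le_prod_norm {X ι : Type*} [TopologicalSpace X] [CompactSpace X]
    (s : Finset ι) (e : ι → C(X, ℝ)) : ‖∏ i ∈ s, e i‖ ≤ ∏ i ∈ s, ‖e i‖ := by
  refine (ContinuousMap.norm_le _ (by positivity)).2 fun x => ?_
  rw [ContinuousMap.prod_apply, norm_prod]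
  exact Finset.prod_le_prod (fun _ _ => norm_nonneg _) fun i _ => (e i).norm_coe_le_norm x

open scoped Nat in
/-- A continuous functional vanishing on all sections of the exponential kernel vanishes on all
monomials in the features. -/
theorem ContinuousMap.map_prod_eq_zero_of_map_exp_eq_zero {X ι : Type*} [TopologicalSpace X]
    [CompactSpace X] [Fintype ι] (e : ι → C(X, ℝ)) (L : StrongDual ℝ C(X, ℝ))
    (hL : ∀ y, L (NormedSpace.exp (∑ i, e i y • e i)) = 0) {n : ℕ} (w : Fin n → ι) :
    L (∏ j, e (w j)) = 0 := by
  set G : ℕ → C(X, ℝ) :=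
    fun n => (n ! : ℝ)⁻¹ • ∑ w : Fin n → ι, L (∏ j, e (w j)) • ∏ j, e (w j) with hG
  have hsummable : Summable G := by
    refine .of_norm_bounded
      ((Real.summable_pow_div_factorial (∑ i, ‖e i‖ ^ 2)).mul_left ‖L‖) fun n => ?_
    rw [hG, norm_smul, norm_inv, Real.norm_natCast, div_eq_inv_mul, mul_left_comm]
    gcongr
    rw [Fintype.sum_pow, Finset.mul_sum]
    refine (norm_sum_le _ _).trans (Finset.sum_le_sum fun w _ => ?_)
    have hw := ContinuousMap.norm_prod_le_prod_norm Finset.univ fun j => e (w j)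
    calc ‖L (∏ j, e (w j)) • ∏ j, e (w j)‖
        ≤ ‖L‖ * ‖∏ j, e (w j)‖ * ‖∏ j, e (w j)‖ := by
          rw [norm_smul]
          gcongr
          exact L.le_opNorm _
      _ ≤ ‖L‖ * (∏ j, ‖e (w j)‖) * ∏ j, ‖e (w j)‖ := by gcongr
      _ = ‖L‖ * ∏ j, ‖e (w j)‖ ^ 2 := by rw [Finset.prod_pow, sq, mul_assoc]
  have hzero : HasSum G 0 := by
    convert hsummable.hasSum
    ext y
    have h₁ : HasSum (fun n => G n y) ((∑' n, G n) y) :=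
      hsummable.hasSum.map (ContinuousMap.evalAlgHom ℝ ℝ y) (continuous_eval_const y)
    have h₂ := (ContinuousMap.hasSum_exp_sum_smul e y).mapL L
    rw [hL] at h₂
    refine h₂.unique ?_
    refine h₁.congr_fun fun n => ?_
    simp [hG, mul_comm]
  have hterm : ∀ m, L (G m) = (m ! : ℝ)⁻¹ * ∑ w : Fin m → ι, L (∏ j, e (w j)) ^ 2 := by
    intro m
    simp [hG, sq]
  have hLG := hzero.mapL L
  rw [map_zero, hasSum_zero_iff_of_nonneg
    (fun m => by simp only [hterm]; positivity)] at hLG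
  have hn := congrFun hLG n
  simp only [hterm, Pi.zero_apply, mul_eq_zero, inv_eq_zero, Nat.cast_eq_zero,
    Nat.factorial_ne_zero, false_or] at hn
  rw [Finset.sum_eq_zero_iff_of_nonneg fun _ _ => sq_nonneg _] at hn
  exact pow_eq_zero_iff two_ne_zero |>.1 (hn w (Finset.mem_univ w))

/-- If finitely many features separate points of a compact space, then the sections of the
associated exponential kernel span a dense subspace. -/
theorem ContinuousMap.topologicalClosure_span_exp_eq_top {X ι : Type*} [TopologicalSpace X]
    [CompactSpace X] [Fintype ι] (e : ι → C(X, ℝ))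
    (he : ∀ x y, (∀ i, e i x = e i y) → x = y) :
    (Submodule.span ℝ
      (Set.range fun y => NormedSpace.exp (∑ i, e i y • e i))).topologicalClosure = ⊤ := by
  set S := Submodule.span ℝ (Set.range fun y => NormedSpace.exp (∑ i, e i y • e i))
  by_contra hS
  obtain ⟨f, hf⟩ : ∃ f, f ∉ S.topologicalClosure := by
    by_contra! h
    exact hS (Submodule.eq_top_iff'.2 h)
  obtain ⟨L, u, hLu, huf⟩ := geometric_hahn_banach_closed_point
    S.topologicalClosure.convex S.isClosed_topologicalClosure hf
  have hu : 0 < u := by simpa using hLu 0 (zero_mem _)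
  have hLS : ∀ g ∈ S, L g = 0 := by
    intro g hg
    by_contra h
    have := hLu ((u / L g) • g) (S.le_topologicalClosure (S.smul_mem _ hg))
    simp [h] at this
  have hmon : ∀ {n : ℕ} (w : Fin n → ι), L (∏ j, e (w j)) = 0 :=
    ContinuousMap.map_prod_eq_zero_of_map_exp_eq_zero e L fun y =>
      hLS _ (Submodule.subset_span ⟨y, rfl⟩)
  set A := Algebra.adjoin ℝ (Set.range e)
  have hAL : (A : Set C(X, ℝ)) ⊆ {g | L g = 0} := by
    have : Subalgebra.toSubmodule A ≤ LinearMap.ker L.toLinearMap := by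
      rw [Algebra.adjoin_eq_span, Submodule.span_le]
      intro g hg
      obtain ⟨l, hl, rfl⟩ := Submonoid.exists_list_of_mem_closure hg
      choose w hw using fun j : Fin l.length => hl _ (l.get_mem j)
      have := hmon w
      simp only [hw, List.prod_ofFn.symm, List.ofFn_get] at this
      exact this
    exact this
  have hsep : A.SeparatesPoints := by
    intro x y hxy
    obtain ⟨i, hi⟩ : ∃ i, e i x ≠ e i y := by
      by_contra! h
      exact hxy (he x y h)
    exact ⟨e i, ⟨e i, Algebra.subset_adjoin ⟨i, rfl⟩, rfl⟩, hi⟩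
  have hLf : L f = 0 := closure_minimal hAL (isClosed_eq L.continuous continuous_const)
    (ContinuousMap.continuousMap_mem_subalgebra_closure_of_separatesPoints A hsep f)
  linarith

/-- **The exponential inner-product kernel is universal on compact subsets of `ℝ^p`.**
For every `σ > 0` and compact `K ⊆ ℝ^p`, the linear span of the functions
`x ↦ exp(⟨x,y⟩/σ)`, `y ∈ K`, is dense in `C(K, ℝ)` with the supremum norm:
every continuous function on `K` can be uniformly approximated on `K` by
finite linear combinations of such functions. -/
theorem exp_inner_kernel_universal_on_compact
    (p : ℕ) (σ : ℝ) (hσ : 0 < σ)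
    (K : Set (EuclideanSpace ℝ (Fin p))) (hK : IsCompact K)
    (f : EuclideanSpace ℝ (Fin p) → ℝ) (hf : ContinuousOn f K)
    (ε : ℝ) (hε : 0 < ε) :
    ∃ (n : ℕ) (c : Fin n → ℝ) (y : Fin n → EuclideanSpace ℝ (Fin p)),
      (∀ i, y i ∈ K) ∧
        ∀ x ∈ K, |f x - ∑ i, c i * Real.exp ((⟪x, y i⟫ : ℝ) / σ)| < ε := by
  have : CompactSpace K := isCompact_iff_compactSpace.1 hK
  let e : Fin p → C(K, ℝ) := fun i => ⟨fun x => x.1 i / √σ, by fun_prop⟩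
  have hker : ∀ x y : K,
      NormedSpace.exp (∑ i, e i y • e i) x = Real.exp (⟪x.1, y.1⟫ / σ) := by
    intro x y
    rw [ContinuousMap.exp_apply, PiLp.inner_apply, Finset.sum_div, ContinuousMap.sum_apply]
    congr 1
    refine Finset.sum_congr rfl fun i _ => ?_
    simp [e, div_mul_div_comm, Real.mul_self_sqrt hσ.le]
  have hdense := ContinuousMap.topologicalClosure_span_exp_eq_top e fun x y h => by
    ext i
    simpa [e, div_left_inj' (Real.sqrt_pos.2 hσ).ne'] using h i
  have hmem := (Submodule.eq_top_iff'.1 hdense) ⟨K.domRestrict f, hf.domRestrict⟩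
  obtain ⟨g, hg, hfg⟩ := Metric.mem_closure_iff.1 hmem ε hε
  obtain ⟨n, c, s, rfl⟩ := Submodule.mem_span_set'.1 hg
  choose y hy using fun i => (s i).2
  refine ⟨n, c, fun i => y i, fun i => (y i).2, fun x hx => ?_⟩
  have hx := (ContinuousMap.dist_apply_le_dist ⟨x, hx⟩).trans_lt hfg
  simpa [Real.dist_eq, ContinuousMap.sum_apply, ← hy, hker] using hx
end

section
/- The Gaussian kernel is universal on compact subsets of ℝ^p: for every σ > 0 and every compact set K ⊆ ℝ^p, the linear span of the functions {x ↦ exp(−‖x − y‖²/(2σ²)) : y ∈ K} is dense in the space C(K) of continuous real-valued functions on K with the supremum norm. -/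
open scoped Nat

/-- Hahn–Banach: a continuous functional separates a closed subspace from an outside point. -/
theorem Submodule.exists_strongDual_ne_zero_of_notMem {E : Type*} [NormedAddCommGroup E]
    [NormedSpace ℝ E] (S : Submodule ℝ E) (hS : IsClosed (S : Set E)) {x : E} (hx : x ∉ S) :
    ∃ L : StrongDual ℝ E, (∀ v ∈ S, L v = 0) ∧ L x ≠ 0 := by
  obtain ⟨L, u, hu, hux⟩ := geometric_hahn_banach_closed_point S.convex hS hx
  have hu0 : 0 < u := by simpa using hu 0 S.zero_mem
  refine ⟨L, fun v hv => ?_, (hu0.trans hux).ne'⟩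
  by_contra hne
  have h := hu ((u / L v) • v) (S.smul_mem _ hv)
  rw [map_smul, smul_eq_mul, div_mul_cancel₀ _ hne] at h
  exact lt_irrefl _ h

namespace ContinuousMap

variable {T ι : Type*} [TopologicalSpace T]

theorem norm_prod_le_prod_norm_s13 [CompactSpace T] {κ : Type*} (s : Finset κ) (X : κ → C(T, ℝ)) :
    ‖∏ j ∈ s, X j‖ ≤ ∏ j ∈ s, ‖X j‖ := by
  rw [norm_le _ (Finset.prod_nonneg fun _ _ => norm_nonneg _)]
  intro x
  rw [prod_apply, norm_prod]
  exact Finset.prod_le_prod (fun _ _ => norm_nonneg _) fun j _ => (X j).norm_coe_le_norm x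

/-- The monomials in the `X i`, multiplied by `g`. -/
noncomputable def expFeature (g : C(T, ℝ)) (X : ι → C(T, ℝ)) {n : ℕ} (s : Fin n → ι) : C(T, ℝ) :=
  g * ∏ j, X (s j)

theorem expFeature_apply (g : C(T, ℝ)) (X : ι → C(T, ℝ)) {n : ℕ} (s : Fin n → ι) (x : T) :
    expFeature g X s x = g x * ∏ j, X (s j) x := by
  simp [expFeature, prod_apply]

theorem norm_expFeature_le [CompactSpace T] (g : C(T, ℝ)) (X : ι → C(T, ℝ)) {n : ℕ} (s : Fin n → ι) :
    ‖expFeature g X s‖ ≤ ‖g‖ * ∏ j, ‖X (s j)‖ :=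
  (norm_mul_le _ _).trans
    (mul_le_mul_of_nonneg_left (norm_prod_le_prod_norm_s13 _ _) (norm_nonneg _))

variable [Fintype ι]

/-- The kernel `(x, y) ↦ g x * g y * exp (∑ i, X i x * X i y)`, as a function of `x`. -/
noncomputable def expKernel (g : C(T, ℝ)) (X : ι → C(T, ℝ)) (y : T) : C(T, ℝ) where
  toFun x := g x * g y * Real.exp (∑ i, X i x * X i y)

variable [CompactSpace T]

/-- The kernel sections expand in the features `expFeature g X s`. -/
theorem hasSum_expKernel (g : C(T, ℝ)) (X : ι → C(T, ℝ)) (y : T) :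
    HasSum (fun n : ℕ => (n ! : ℝ)⁻¹ • ∑ s : Fin n → ι, expFeature g X s y • expFeature g X s)
      (expKernel g X y) := by
  have h := (NormedSpace.exp_series_hasSum_exp' (𝕂 := ℝ) (∑ i, X i y • X i)).mul_left (g y • g)
  have hexp : (g y • g) * NormedSpace.exp (∑ i, X i y • X i) = expKernel g X y := by
    ext x
    have h1 := (NormedSpace.exp_series_hasSum_exp' (𝕂 := ℝ) (∑ i, X i y • X i)).mapL
      (evalCLM ℝ x)
    have h2 := NormedSpace.exp_series_hasSum_exp' (𝕂 := ℝ) (∑ i, X i x * X i y)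
    rw [← Real.exp_eq_exp_ℝ] at h2
    have h3 := h1.unique (h2.congr_fun (fun n => ?_))
    · change g y * g x * _ = g x * g y * _
      rw [← h3, mul_comm (g y)]
      rfl
    · simp [sum_apply, mul_comm]
  rw [hexp] at h
  refine h.congr_fun fun n => ?_
  rw [Fintype.sum_pow, mul_smul_comm, Finset.mul_sum]
  congr 1
  refine Finset.sum_congr rfl fun s _ => ?_
  ext x
  simp only [expFeature_apply, mul_apply, smul_apply, prod_apply, smul_eq_mul,
    Finset.prod_mul_distrib]
  ring

theorem summable_expFeature (g : C(T, ℝ)) (X : ι → C(T, ℝ)) (L : StrongDual ℝ C(T, ℝ)) :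
    Summable fun n : ℕ =>
      (n ! : ℝ)⁻¹ • ∑ s : Fin n → ι, L (expFeature g X s) • expFeature g X s := by
  have hsum : Summable fun n : ℕ => ‖L‖ * ‖g‖ ^ 2 * ((∑ i, ‖X i‖ ^ 2) ^ n / n !) :=
    (Real.summable_pow_div_factorial (∑ i, ‖X i‖ ^ 2)).mul_left (‖L‖ * ‖g‖ ^ 2)
  refine Summable.of_norm_bounded hsum fun n => ?_
  have h : ‖∑ s : Fin n → ι, L (expFeature g X s) • expFeature g X s‖ ≤
      ‖L‖ * ‖g‖ ^ 2 * (∑ i, ‖X i‖ ^ 2) ^ n := by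
    rw [Fintype.sum_pow, Finset.mul_sum]
    refine norm_sum_le_of_le _ fun s _ => ?_
    calc ‖L (expFeature g X s) • expFeature g X s‖
        ≤ ‖L‖ * ‖expFeature g X s‖ * ‖expFeature g X s‖ := by
          rw [norm_smul]
          gcongr
          exact L.le_opNorm _
      _ ≤ ‖L‖ * (‖g‖ * ∏ j, ‖X (s j)‖) * (‖g‖ * ∏ j, ‖X (s j)‖) := by
          gcongr <;> exact norm_expFeature_le g X s
      _ = ‖L‖ * ‖g‖ ^ 2 * ∏ j, ‖X (s j)‖ ^ 2 := by
          rw [Finset.prod_pow]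
          ring
  rw [norm_smul, norm_inv, RCLike.norm_natCast, ← mul_div_assoc, div_eq_inv_mul]
  gcongr

/-- A functional that kills every kernel section kills every feature. -/
theorem apply_expFeature_eq_zero (g : C(T, ℝ)) (X : ι → C(T, ℝ)) (L : StrongDual ℝ C(T, ℝ))
    (hL : ∀ y, L (expKernel g X y) = 0) {n : ℕ} (s : Fin n → ι) : L (expFeature g X s) = 0 := by
  obtain ⟨h, hh⟩ := summable_expFeature g X L
  have h0 : h = 0 := by
    ext y
    have h1 := (hasSum_expKernel g X y).mapL L
    rw [hL] at h1
    refine (hh.mapL (evalCLM ℝ y)).unique (h1.congr_fun fun m => ?_)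
    simp [mul_comm]
  have hsq := hh.mapL L
  rw [h0, map_zero] at hsq
  simp only [map_smul, map_sum, smul_eq_mul] at hsq
  have hn : (n ! : ℝ)⁻¹ * ∑ s : Fin n → ι, L (expFeature g X s) * L (expFeature g X s) = 0 :=
    congrFun ((hasSum_zero_iff_of_nonneg fun m => mul_nonneg (by positivity)
      (Finset.sum_nonneg fun _ _ => mul_self_nonneg _)).1 hsq) n
  have hs := (mul_eq_zero.1 hn).resolve_left (by positivity)
  exact mul_self_eq_zero.1
    ((Finset.sum_eq_zero_iff_of_nonneg fun _ _ => mul_self_nonneg _).1 hs s (Finset.mem_univ s))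

/-- If `g` has no zeros and the `X i` separate points, then `expKernel g X` is universal. -/
theorem topologicalClosure_span_range_expKernel (g : C(T, ℝ)) (hg : ∀ x, g x ≠ 0)
    (X : ι → C(T, ℝ)) (hX : ∀ x y, (∀ i, X i x = X i y) → x = y) :
    (Submodule.span ℝ (Set.range (expKernel g X))).topologicalClosure = ⊤ := by
  rw [Submodule.eq_top_iff']
  intro f
  by_contra hf
  obtain ⟨L, hL, hLf⟩ := Submodule.exists_strongDual_ne_zero_of_notMem _
    (Submodule.isClosed_topologicalClosure _) hf
  apply hLf
  have hfeat {n : ℕ} (s : Fin n → ι) : L (expFeature g X s) = 0 :=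
    apply_expFeature_eq_zero g X L (fun y => hL _ (Submodule.le_topologicalClosure _
      (Submodule.subset_span ⟨y, rfl⟩))) s
  let M : StrongDual ℝ C(T, ℝ) := L.comp (ContinuousLinearMap.mul ℝ C(T, ℝ) g)
  let A := Algebra.adjoin ℝ (Set.range X)
  have hAsep : A.SeparatesPoints := by
    intro x y hxy
    obtain ⟨i, hi⟩ : ∃ i, X i x ≠ X i y := by
      by_contra! h
      exact hxy (hX x y h)
    exact ⟨X i, ⟨X i, Algebra.subset_adjoin ⟨i, rfl⟩, rfl⟩, hi⟩
  have hmon (m : C(T, ℝ)) (hm : m ∈ Submonoid.closure (Set.range X)) :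
      ∃ (n : ℕ) (s : Fin n → ι), m = ∏ j, X (s j) := by
    induction hm using Submonoid.closure_induction_left with
    | one => exact ⟨0, Fin.elim0, by simp⟩
    | mul_left x hx y hy ih =>
      obtain ⟨i, rfl⟩ := hx
      obtain ⟨n, s, rfl⟩ := ih
      exact ⟨n + 1, Fin.cons i s, by simp [Fin.prod_univ_succ]⟩
  have hA : (A : Set C(T, ℝ)) ⊆ {q | M q = 0} := by
    have hle : Subalgebra.toSubmodule A ≤ LinearMap.ker (M : C(T, ℝ) →ₗ[ℝ] ℝ) := by
      rw [Algebra.adjoin_eq_span, Submodule.span_le]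
      intro m hm
      obtain ⟨n, s, rfl⟩ := hmon m hm
      exact hfeat s
    exact fun q hq => hle hq
  have hM (q : C(T, ℝ)) : M q = 0 := by
    have hq : q ∈ A.topologicalClosure := by
      rw [subalgebra_topologicalClosure_eq_top_of_separatesPoints A hAsep]
      trivial
    exact closure_minimal hA (isClosed_eq M.continuous continuous_const) hq
  have h := hM ⟨fun x => f x / g x, f.continuous.div g.continuous hg⟩
  convert h using 1
  change L f = L (g * _)
  congr 1
  ext x
  exact (mul_div_cancel₀ _ (hg x)).symm

end ContinuousMap

/-- The Gaussian kernel as an exponential of the inner product of rescaled coordinates. -/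
theorem EuclideanSpace.exp_neg_norm_sub_sq_div {p : ℕ} {σ : ℝ} (hσ : σ ≠ 0)
    (x y : EuclideanSpace ℝ (Fin p)) :
    Real.exp (-‖x - y‖ ^ 2 / (2 * σ ^ 2)) =
      Real.exp (-‖x‖ ^ 2 / (2 * σ ^ 2)) * Real.exp (-‖y‖ ^ 2 / (2 * σ ^ 2)) *
        Real.exp (∑ i, x i / σ * (y i / σ)) := by
  have h : ∑ i, x i / σ * (y i / σ) = inner ℝ x y / σ ^ 2 := by
    rw [PiLp.inner_apply, Finset.sum_div]
    refine Finset.sum_congr rfl fun i _ => ?_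
    simp only [RCLike.inner_apply, conj_trivial]
    field_simp
  rw [h, ← Real.exp_add, ← Real.exp_add, norm_sub_sq_real]
  congr 1
  field_simp
  ring

/-- **The Gaussian kernel is universal on compact subsets of `ℝ^p`.**
For every `σ > 0` and compact `K ⊆ ℝ^p`, the linear span of the functions
`x ↦ exp(−‖x−y‖²/(2σ²))`, `y ∈ K`, is dense in `C(K, ℝ)` with the supremum
norm: every continuous function on `K` can be uniformly approximated on `K`
by finite linear combinations of such functions. -/
theorem gaussian_kernel_universal_on_compact
    (p : ℕ) (σ : ℝ) (hσ : 0 < σ)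
    (K : Set (EuclideanSpace ℝ (Fin p))) (hK : IsCompact K)
    (f : EuclideanSpace ℝ (Fin p) → ℝ) (hf : ContinuousOn f K)
    (ε : ℝ) (hε : 0 < ε) :
    ∃ (n : ℕ) (c : Fin n → ℝ) (y : Fin n → EuclideanSpace ℝ (Fin p)),
      (∀ i, y i ∈ K) ∧
        ∀ x ∈ K, |f x - ∑ i, c i * Real.exp (-‖x - y i‖ ^ 2 / (2 * σ ^ 2))| < ε := by
  have : CompactSpace K := isCompact_iff_compactSpace.1 hK
  let g : C(K, ℝ) := ⟨fun x => Real.exp (-‖(x : EuclideanSpace ℝ (Fin p))‖ ^ 2 / (2 * σ ^ 2)),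
    by fun_prop⟩
  let X : Fin p → C(K, ℝ) := fun i => ⟨fun x => (x : EuclideanSpace ℝ (Fin p)) i / σ, by fun_prop⟩
  have hdense := ContinuousMap.topologicalClosure_span_range_expKernel g
    (fun x => (Real.exp_pos _).ne') X fun x y h => by
      ext i
      exact (div_left_inj' hσ.ne').1 (h i)
  let F : C(K, ℝ) := ⟨K.domRestrict f, hf.domRestrict⟩
  have hF : F ∈ closure (Submodule.span ℝ (Set.range (ContinuousMap.expKernel g X)) :
      Set C(K, ℝ)) := by
    rw [← Submodule.topologicalClosure_coe, hdense]
    trivial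
  obtain ⟨q, hq, hFq⟩ := Metric.mem_closure_iff.1 hF ε hε
  obtain ⟨n, c, v, rfl⟩ := Submodule.mem_span_set'.1 hq
  choose y hy using fun i => (v i).2
  refine ⟨n, c, fun i => y i, fun i => (y i).2, fun x hx => ?_⟩
  have hd := (ContinuousMap.dist_apply_le_dist (f := F) ⟨x, hx⟩).trans_lt hFq
  have hsum : ∑ i, c i * Real.exp (-‖x - y i‖ ^ 2 / (2 * σ ^ 2)) =
      (∑ i, c i • (v i : C(K, ℝ))) ⟨x, hx⟩ := by
    rw [ContinuousMap.sum_apply]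
    refine Finset.sum_congr rfl fun i _ => ?_
    rw [ContinuousMap.smul_apply, ← hy i, EuclideanSpace.exp_neg_norm_sub_sq_div hσ.ne']
    rfl
  rw [hsum]
  exact hd
end

section
/- Let X and Y be random variables with values in ℝ^p and ℝ^q, and let W : ℝ^p × ℝ^q → (0,∞) be a strictly positive Lebesgue-integrable weight function. Denote by f_{XY}(s,t) = E[e^{i(⟨s,X⟩+⟨t,Y⟩)}] the joint characteristic function and by f_X(s) = E[e^{i⟨s,X⟩}], f_Y(t) = E[e^{i⟨t,Y⟩}] the marginal characteristic functions. Then ∫_{ℝ^q}∫_{ℝ^p} |f_{XY}(s,t) − f_X(s) f_Y(t)|² W(s,t) ds dt = 0 if and only if X and Y are independent. -/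
open MeasureTheory ProbabilityTheory Complex
open scoped RealInnerProductSpace

/-- The integral of a unimodular exponential with a continuous real phase depends continuously on
the parameter. -/
lemma continuous_integral_exp_I_mul {Ω T : Type*} [MeasurableSpace Ω] [TopologicalSpace T]
    [FirstCountableTopology T] (μ : Measure Ω) [IsFiniteMeasure μ] {φ : T → Ω → ℝ}
    (hφ_meas : ∀ z, Measurable (φ z)) (hφ_cont : ∀ ω, Continuous fun z ↦ φ z ω) :
    Continuous fun z ↦ ∫ ω, Complex.exp (Complex.I * (φ z ω : ℝ)) ∂μ := by
  refine continuous_of_dominated (bound := fun _ ↦ 1) (fun z ↦ ?_) (fun z ↦ ?_)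
    (integrable_const 1) ?_
  · have := hφ_meas z
    exact Measurable.aestronglyMeasurable (by fun_prop)
  · exact .of_forall fun ω ↦ by rw [mul_comm, Complex.norm_exp_ofReal_mul_I]
  · exact .of_forall fun ω ↦ by
      have := hφ_cont ω
      fun_prop

lemma norm_integral_exp_I_mul_le_one {Ω : Type*} [MeasurableSpace Ω] (μ : Measure Ω)
    [IsProbabilityMeasure μ] (φ : Ω → ℝ) :
    ‖∫ ω, Complex.exp (Complex.I * (φ ω : ℝ)) ∂μ‖ ≤ 1 := by
  simpa using norm_integral_le_of_norm_le_const (μ := μ) (C := 1)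
    (.of_forall fun ω ↦ by rw [mul_comm, Complex.norm_exp_ofReal_mul_I])

/-- For a continuous bounded function and a strictly positive integrable weight, the weighted
squared `L²` norm vanishes only for the zero function. -/
lemma integral_norm_sq_mul_eq_zero_iff {T : Type*} [TopologicalSpace T] [MeasurableSpace T]
    [BorelSpace T] {ν : Measure T} [ν.IsOpenPosMeasure] {F : T → ℂ}
    (hF : Continuous F) {C : ℝ} (hFC : ∀ z, ‖F z‖ ≤ C) {W : T → ℝ} (hW_pos : ∀ z, 0 < W z)
    (hW : Integrable W ν) :
    Integrable (fun z ↦ ‖F z‖ ^ 2 * W z) ν ∧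
      ((∫ z, ‖F z‖ ^ 2 * W z ∂ν) = 0 ↔ ∀ z, F z = 0) := by
  have h_int : Integrable (fun z ↦ ‖F z‖ ^ 2 * W z) ν := by
    refine hW.bdd_mul (c := C ^ 2) (hF.norm.pow 2).measurable.aestronglyMeasurable
      (.of_forall fun z ↦ ?_)
    rw [norm_pow, norm_norm]
    exact pow_le_pow_left₀ (norm_nonneg _) (hFC z) 2
  refine ⟨h_int, ?_⟩
  rw [integral_eq_zero_iff_of_nonneg
    (fun z ↦ mul_nonneg (sq_nonneg _) (hW_pos z).le) h_int]
  refine ⟨fun h ↦ ?_, fun h ↦ .of_forall fun z ↦ by simp [h z]⟩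
  have h_ae : F =ᵐ[ν] fun _ ↦ 0 := by
    filter_upwards [h] with z hz
    simpa [(hW_pos z).ne'] using hz
  exact congrFun ((hF.ae_eq_iff_eq ν continuous_const).1 h_ae)

/-- Independence is the factorization of the joint characteristic function. -/
lemma indepFun_iff_integral_exp_inner_eq_mul {Ω E F : Type*} [MeasurableSpace Ω]
    {μ : Measure Ω} [IsFiniteMeasure μ]
    [NormedAddCommGroup E] [InnerProductSpace ℝ E] [CompleteSpace E] [MeasurableSpace E]
    [BorelSpace E] [SecondCountableTopology E]
    [NormedAddCommGroup F] [InnerProductSpace ℝ F] [CompleteSpace F] [MeasurableSpace F]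
    [BorelSpace F] [SecondCountableTopology F]
    {X : Ω → E} {Y : Ω → F} (hX : Measurable X) (hY : Measurable Y) :
    IndepFun X Y μ ↔ ∀ z : E × F,
      ∫ ω, Complex.exp (Complex.I * ((⟪z.1, X ω⟫ + ⟪z.2, Y ω⟫ : ℝ) : ℂ)) ∂μ =
        (∫ ω, Complex.exp (Complex.I * (⟪z.1, X ω⟫ : ℝ)) ∂μ) *
          ∫ ω, Complex.exp (Complex.I * (⟪z.2, Y ω⟫ : ℝ)) ∂μ := by
  have hXY : Measurable fun ω ↦ WithLp.toLp 2 (X ω, Y ω) := by fun_prop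
  rw [indepFun_iff_charFun_prod hX.aemeasurable hY.aemeasurable,
    (WithLp.equiv 2 (E × F)).forall_congr_left]
  refine forall_congr' fun z ↦ ?_
  simp only [charFun_apply]
  rw [integral_map hXY.aemeasurable (Measurable.aestronglyMeasurable (by fun_prop)),
    integral_map hX.aemeasurable (Measurable.aestronglyMeasurable (by fun_prop)),
    integral_map hY.aemeasurable (Measurable.aestronglyMeasurable (by fun_prop))]
  simp [WithLp.prod_inner_apply, real_inner_comm, mul_comm]

/-- **Characteristic-function criterion for independence.**
For random variables `X : Ω → ℝ^p`, `Y : Ω → ℝ^q` and a strictly positive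
Lebesgue-integrable weight `W` on `ℝ^p × ℝ^q`, the weighted `L²` distance
`∫∫ |f_{XY}(s,t) − f_X(s) f_Y(t)|² W(s,t) ds dt` between the joint
characteristic function and the product of the marginal characteristic
functions vanishes if and only if `X` and `Y` are independent. -/
theorem weighted_ecf_distance_eq_zero_iff_indepFun
    (p q : ℕ) {Ω : Type*} [MeasurableSpace Ω] (μ : Measure Ω) [IsProbabilityMeasure μ]
    (X : Ω → EuclideanSpace ℝ (Fin p)) (Y : Ω → EuclideanSpace ℝ (Fin q))
    (hX : Measurable X) (hY : Measurable Y)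
    (W : EuclideanSpace ℝ (Fin p) × EuclideanSpace ℝ (Fin q) → ℝ)
    (hW_pos : ∀ z, 0 < W z)
    (hW_int : Integrable W (volume.prod volume))
    (fXY : EuclideanSpace ℝ (Fin p) → EuclideanSpace ℝ (Fin q) → ℂ)
    (hfXY : ∀ s t, fXY s t =
      ∫ ω, Complex.exp (Complex.I * ((⟪s, X ω⟫ : ℝ) + (⟪t, Y ω⟫ : ℝ))) ∂μ)
    (fX : EuclideanSpace ℝ (Fin p) → ℂ)
    (hfX : ∀ s, fX s = ∫ ω, Complex.exp (Complex.I * (⟪s, X ω⟫ : ℝ)) ∂μ)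
    (fY : EuclideanSpace ℝ (Fin q) → ℂ)
    (hfY : ∀ t, fY t = ∫ ω, Complex.exp (Complex.I * (⟪t, Y ω⟫ : ℝ)) ∂μ) :
    (∫ t, ∫ s, ‖fXY s t - fX s * fY t‖ ^ 2 * W (s, t) ∂volume ∂volume) = 0 ↔
      IndepFun X Y μ := by
  have hfXY' : ∀ s t, fXY s t =
      ∫ ω, Complex.exp (Complex.I * ((⟪s, X ω⟫ + ⟪t, Y ω⟫ : ℝ) : ℂ)) ∂μ := by
    simpa only [Complex.ofReal_add] using hfXY
  have hXY_cont : Continuous fun z : EuclideanSpace ℝ (Fin p) × EuclideanSpace ℝ (Fin q) ↦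
      fXY z.1 z.2 := by
    simp only [hfXY']
    exact continuous_integral_exp_I_mul μ (fun z ↦ by fun_prop) (fun ω ↦ by fun_prop)
  have hX_cont : Continuous fX := by
    rw [funext hfX]
    exact continuous_integral_exp_I_mul μ (fun z ↦ by fun_prop) (fun ω ↦ by fun_prop)
  have hY_cont : Continuous fY := by
    rw [funext hfY]
    exact continuous_integral_exp_I_mul μ (fun z ↦ by fun_prop) (fun ω ↦ by fun_prop)
  have h_bound : ∀ z : EuclideanSpace ℝ (Fin p) × EuclideanSpace ℝ (Fin q),
      ‖fXY z.1 z.2 - fX z.1 * fY z.2‖ ≤ 1 + 1 * 1 := fun z ↦ by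
    refine norm_sub_le_of_le ?_ (norm_mul_le_of_le ?_ ?_)
    · rw [hfXY']
      exact norm_integral_exp_I_mul_le_one μ _
    · rw [hfX]
      exact norm_integral_exp_I_mul_le_one μ _
    · rw [hfY]
      exact norm_integral_exp_I_mul_le_one μ _
  obtain ⟨h_int, h_iff⟩ := integral_norm_sq_mul_eq_zero_iff
    (F := fun z : EuclideanSpace ℝ (Fin p) × EuclideanSpace ℝ (Fin q) ↦
      fXY z.1 z.2 - fX z.1 * fY z.2) (by fun_prop) h_bound hW_pos hW_int
  rw [← integral_prod_symm _ h_int, h_iff, indepFun_iff_integral_exp_inner_eq_mul hX hY]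
  simp only [sub_eq_zero, hfXY', hfX, hfY]
end
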